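/- arXiv:2104.11670 — 3 statements merged into one kernel-verified Lean document; each statement's English description precedes it below -/
import Mathlib

section
/- Fix an integer d ≥ 3 and reals h,γ > 0. There exist constants c > 0 and ε₀ > 0 (depending only on d, h, γ) such that for every ε ∈ (0,ε₀) and every sufficiently large n (depending on ε), for every pair of graphs G, H on n vertices satisfying the hypotheses, every family M of bijections, and every integral solution f of the 0-Extension instance 𝓘(X(G,H,M)) whose cost is at most c·ε²·n²·(log n)^{2/3}, there exists a map f̄ which is an (ε·(log n)^{4/3}, ε)-split. -/
open Finset

noncomputable section

/-- A semi-metric on a type `V`. -/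
def IsSemiMetric {V : Type} (δ : V → V → ℝ) : Prop :=
  (∀ u v, 0 ≤ δ u v) ∧ (∀ u, δ u u = 0) ∧ (∀ u v, δ u v = δ v u) ∧
    ∀ u v w, δ u w ≤ δ u v + δ v w

/-- The length of a walk with respect to edge lengths `ℓ`. -/
def walkCost {V : Type} {Gr : SimpleGraph V} (ℓ : Sym2 V → ℝ) {u v : V} (p : Gr.Walk u v) : ℝ :=
  (p.edges.map ℓ).sum

/-- The shortest-path (semi-)metric of the graph `Gr` with edge lengths `ℓ`. -/
def spDist {V : Type} (Gr : SimpleGraph V) (ℓ : Sym2 V → ℝ) (u v : V) : ℝ :=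
  sInf {r : ℝ | ∃ p : Gr.Walk u v, r = walkCost ℓ p}

/-- `EO` is an orientation of the edges of `G`: it consists of ordered pairs of adjacent
vertices and contains exactly one of the two orientations of every edge of `G`. -/
def IsOrientation {V : Type} (G : SimpleGraph V) (EO : Finset (V × V)) : Prop :=
  (∀ p ∈ EO, G.Adj p.1 p.2) ∧ ∀ a b : V, G.Adj a b → ((a, b) ∈ EO ↔ (b, a) ∉ EO)

variable {VG VH : Type}

/-- The defining relation of the extension graph `X(G,H,M)`: intra-cloud edges coming from
`H`, and inter-cloud matching edges determined by the bijections `M_e`, `e ∈ EG`. -/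
def ExtRel (H : SimpleGraph VH) (EG : Finset (VG × VG)) (M : VG × VG → VH ≃ VH) :
    VG × VH → VG × VH → Prop := fun x y =>
  (x.1 = y.1 ∧ H.Adj x.2 y.2) ∨ ((x.1, y.1) ∈ EG ∧ y.2 = M (x.1, y.1) x.2)

/-- The extension graph `X(G,H,M)` on the vertex set `V_G × V_H`. -/
def ExtGraph (H : SimpleGraph VH) (EG : Finset (VG × VG)) (M : VG × VG → VH ≃ VH) :
    SimpleGraph (VG × VH) := SimpleGraph.fromRel (ExtRel H EG M)

/-- Edge lengths on `X(G,H,M)`: intra-cloud edges have length `(log n)^{1/3}` and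
inter-cloud edges have length `(log n)^{2/3}`. -/
def extLen (n : ℕ) [DecidableEq VG] : Sym2 (VG × VH) → ℝ := fun e =>
  if (Sym2.map Prod.fst e).IsDiag then Real.log n ^ ((1 : ℝ) / 3)
  else Real.log n ^ ((2 : ℝ) / 3)

/-- `D_X`, the shortest-path metric of the extension graph `X(G,H,M)`. -/
def extDist (n : ℕ) [DecidableEq VG] (H : SimpleGraph VH) (EG : Finset (VG × VG))
    (M : VG × VG → VH ≃ VH) : VG × VH → VG × VH → ℝ :=
  spDist (ExtGraph H EG M) (extLen n)

/-- The vertex set of the `0-Extension` instance `𝓘(X)`: the vertices of `X` (`Sum.inl`)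
together with a disjoint copy serving as terminals (`Sum.inr`). -/
abbrev IV (VG VH : Type) : Type := (VG × VH) ⊕ (VG × VH)

/-- The edges of the instance graph `𝒢` of `𝓘(X)`, as oriented pairs: intra-cloud edges
(from an orientation `EH` of `H`), inter-cloud matching edges (from an orientation `EG` of
`G` and the bijections `M`), and the pendant edges `(v, v_T)`. -/
def instEdges [Fintype VG] [Fintype VH] [DecidableEq VG] [DecidableEq VH]
    (EH : Finset (VH × VH)) (EG : Finset (VG × VG)) (M : VG × VG → VH ≃ VH) :
    Finset (IV VG VH × IV VG VH) :=
  ((Finset.univ ×ˢ EH).image fun p => (Sum.inl (p.1, p.2.1), Sum.inl (p.1, p.2.2))) ∪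
    ((EG ×ˢ (Finset.univ : Finset VH)).image fun p =>
      (Sum.inl (p.1.1, p.2), Sum.inl (p.1.2, M p.1 p.2))) ∪
    ((Finset.univ : Finset (VG × VH)).image fun x => (Sum.inl x, Sum.inr x))

/-- The edge weights of `𝓘(X)`: every edge of `X` has weight the reciprocal of its
length, and pendant edges have weight `1/L` with `L = log n`. -/
def instW (n : ℕ) [DecidableEq VG] : IV VG VH × IV VG VH → ℝ := fun p =>
  match p with
  | (Sum.inl x, Sum.inl y) =>
      if x.1 = y.1 then (Real.log n ^ ((1 : ℝ) / 3))⁻¹ else (Real.log n ^ ((2 : ℝ) / 3))⁻¹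
  | (Sum.inl _, Sum.inr _) => (Real.log n)⁻¹
  | _ => 0

/-- The metric on the terminals of `𝓘(X)`: `D(u_T, v_T) = D_X(u,v) + 2L` for `u ≠ v`,
with `L = log n` (extended by `0` on non-terminal arguments). -/
def instD (n : ℕ) [DecidableEq VG] [DecidableEq VH] (H : SimpleGraph VH)
    (EG : Finset (VG × VG)) (M : VG × VG → VH ≃ VH) : IV VG VH → IV VG VH → ℝ := fun a b =>
  match a, b with
  | Sum.inr u, Sum.inr v =>
      if u = v then 0 else extDist n H EG M u v + 2 * Real.log n
  | _, _ => 0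

/-- An integral solution of `𝓘(X)`: a map into the terminals fixing every terminal. -/
def IsIntegralSolution {VG VH : Type} (f : IV VG VH → IV VG VH) : Prop :=
  (∀ v : IV VG VH, ∃ x : VG × VH, f v = Sum.inr x) ∧
    ∀ x : VG × VH, f (Sum.inr x) = Sum.inr x

/-- The cost of an integral solution `f` of `𝓘(X)`. -/
def intCost (n : ℕ) [Fintype VG] [Fintype VH] [DecidableEq VG] [DecidableEq VH]
    (H : SimpleGraph VH) (EH : Finset (VH × VH)) (EG : Finset (VG × VG))
    (M : VG × VG → VH ≃ VH) (f : IV VG VH → IV VG VH) : ℝ :=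
  ∑ p ∈ instEdges EH EG M, instW n p * instD n H EG M (f p.1) (f p.2)

/-- `G` is a Cayley graph of the group `Γ` with respect to `d` generators. -/
def IsCayley {Γ : Type} [Group Γ] (G : SimpleGraph Γ) (d : ℕ) : Prop :=
  ∃ S : Finset Γ, S.card = d ∧ (1 : Γ) ∉ S ∧ (∀ s ∈ S, s⁻¹ ∈ S) ∧
    ∀ a b : Γ, G.Adj a b ↔ a⁻¹ * b ∈ S

/-- Every cycle of `G` has length at least `g`. -/
def GirthAtLeast {V : Type} (G : SimpleGraph V) (g : ℝ) : Prop :=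
  ∀ (v : V) (c : G.Walk v v), c.IsCycle → g ≤ (c.length : ℝ)

/-- `G` has edge expansion at least `h`: every `S` with `|S| ≤ |V|/2` has at least `h·|S|`
edges leaving it (counted as ordered pairs `(u,v)`, `u ∈ S`, `v ∉ S`, `u ~ v`, which
counts each leaving edge exactly once). -/
def EdgeExpansionAtLeast {V : Type} [Fintype V] (G : SimpleGraph V) (h : ℝ) : Prop :=
  ∀ S : Finset V, 2 * S.card ≤ Fintype.card V →
    h * (S.card : ℝ) ≤ ({p : V × V | G.Adj p.1 p.2 ∧ p.1 ∈ S ∧ p.2 ∉ S}.ncard : ℝ)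

/-- The hypotheses on the pair `(G, H)`: both are connected `d`-regular Cayley graphs on
`n` vertices with edge expansion at least `h` and girth at least `γ·log n`. -/
def GoodPair (d : ℕ) (h γ : ℝ) (n : ℕ) {VG VH : Type} [Fintype VG] [Fintype VH]
    [Group VG] [Group VH] (G : SimpleGraph VG) (H : SimpleGraph VH) : Prop :=
  Fintype.card VG = n ∧ Fintype.card VH = n ∧ G.Connected ∧ H.Connected ∧
    (∀ v, (G.neighborSet v).ncard = d) ∧ (∀ v, (H.neighborSet v).ncard = d) ∧
    IsCayley G d ∧ IsCayley H d ∧ EdgeExpansionAtLeast G h ∧ EdgeExpansionAtLeast H h ∧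
    GirthAtLeast G (γ * Real.log n) ∧ GirthAtLeast H (γ * Real.log n)

section Split

variable {VG VH : Type}

/-- The multiset of edges of `G` obtained by projecting a walk of the extension graph to
the graph `G` via `π = Prod.fst` (intra-cloud steps project to loops and are dropped). -/
def projEdges [DecidableEq VG] {X : SimpleGraph (VG × VH)} {a b : VG × VH}
    (p : X.Walk a b) : Multiset (Sym2 VG) :=
  Multiset.filter (fun e => ¬ e.IsDiag)
    (Multiset.map (Sym2.map Prod.fst) (p.edges : Multiset (Sym2 (VG × VH))))

/-- Given, for every edge of a subgraph `G'` of `G`, a multiset of edges of `G`, the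
combined multiset collected along a walk of `G` all of whose edges lie in `G'`. -/
def combinedEdges {V : Type} {G : SimpleGraph V} {G' : G.Subgraph}
    (Q : ∀ {a b : V}, G'.Adj a b → Multiset (Sym2 V)) :
    {u v : V} → (c : G.Walk u v) → (∀ e ∈ c.edges, e ∈ G'.edgeSet) → Multiset (Sym2 V)
  | _, _, SimpleGraph.Walk.nil, _ => 0
  | _, _, @SimpleGraph.Walk.cons _ _ u v w _ p, hmem =>
      Q (SimpleGraph.Subgraph.mem_edgeSet.mp (hmem s(u, v) (by simp))) +
        combinedEdges Q p (fun e he => hmem e (by simp [he]))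

/-- `(f̃, P)` (encoded by the multisets `Q` of edges of the walks `P(e)`) is a
cycle-homeomorphism of `G` with respect to `G'`: for every simple cycle `C` of `G` all of
whose edges lie in `G'`, the set of edges of `G` appearing an odd number of times in the
combined multiset of the walks assigned to the edges of `C` is exactly the edge set of
`C`. -/
def IsCycleHomeo {V : Type} [DecidableEq V] {G : SimpleGraph V} (G' : G.Subgraph)
    (Q : ∀ {a b : V}, G'.Adj a b → Multiset (Sym2 V)) : Prop :=
  ∀ (v : V) (c : G.Walk v v), c.IsCycle →
    ∀ hmem : ∀ e ∈ c.edges, e ∈ G'.edgeSet,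
      {e : Sym2 V | Odd ((combinedEdges Q c hmem).count e)} = {e : Sym2 V | e ∈ c.edges}

end Split

/-- `f̄ : V_{G'} → V_G × V_H` is an `(α, ε)`-split of the extension graph `X(G,H,M)`:
`G'` is a subgraph of `G` with at least `(1−ε)|E_G|` edges; there is a choice `P` of
shortest paths in `X` between the images under `f̄` of the endpoints of each edge of `G'`
whose projections to `G` make `(π ∘ f̄, P_{π∘f̄})` a cycle-homeomorphism of `G` with
respect to `G'`; `D_X(f̄(g₁), f̄(g₂)) < α` for every edge `(g₁,g₂)` of `G'`; and for every
`g ∈ V_{G'}` the shortest path in `G` between `g` and `π(f̄(g))` has at most `ε·log n`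
edges. -/
def IsSplit (n : ℕ) {VG VH : Type} [Fintype VG] [DecidableEq VG] [DecidableEq VH]
    (G : SimpleGraph VG) (H : SimpleGraph VH) (EG : Finset (VG × VG))
    (M : VG × VG → VH ≃ VH) (α ε : ℝ) (G' : G.Subgraph) (fbar : VG → VG × VH) : Prop :=
  (1 - ε) * (G.edgeSet.ncard : ℝ) ≤ (G'.edgeSet.ncard : ℝ) ∧
  (∃ P : ∀ {g₁ g₂ : VG}, G'.Adj g₁ g₂ → (ExtGraph H EG M).Walk (fbar g₁) (fbar g₂),
    (∀ {g₁ g₂ : VG} (hadj : G'.Adj g₁ g₂),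
      walkCost (extLen n) (P hadj) = extDist n H EG M (fbar g₁) (fbar g₂)) ∧
    IsCycleHomeo G' (fun {_ _} hadj => projEdges (P hadj))) ∧
  (∀ {g₁ g₂ : VG}, G'.Adj g₁ g₂ → extDist n H EG M (fbar g₁) (fbar g₂) < α) ∧
  ∀ g ∈ G'.verts, (G.dist g (fbar g).1 : ℝ) ≤ ε * Real.log n

/-- The cloud of a vertex of the instance graph (for a terminal `v_T`, the cloud of `v`). -/
def cloudOf {VG VH : Type} : IV VG VH → VG := fun v =>
  match v with
  | Sum.inl x => x.1
  | Sum.inr x => x.1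

/-- Edge lengths on the instance graph `𝒢` of `𝓘(X)`: every edge coming from `X` keeps
its length in `X` (`(log n)^{1/3}` intra-cloud, `(log n)^{2/3}` inter-cloud) and every
pendant edge `(v, v_T)` has length `L = log n`. -/
def instLen (n : ℕ) {VG VH : Type} [DecidableEq VG] : Sym2 (IV VG VH) → ℝ := fun e =>
  if (Sym2.map Sum.isLeft e).IsDiag then
    (if (Sym2.map cloudOf e).IsDiag then Real.log n ^ ((1 : ℝ) / 3)
      else Real.log n ^ ((2 : ℝ) / 3))
  else Real.log n

/-- The instance graph `𝒢` of `𝓘(X)`, whose edges are the elements of `instEdges`. -/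
def instGraph {VG VH : Type} [Fintype VG] [Fintype VH] [DecidableEq VG] [DecidableEq VH]
    (EH : Finset (VH × VH)) (EG : Finset (VG × VG)) (M : VG × VG → VH ≃ VH) :
    SimpleGraph (IV VG VH) :=
  SimpleGraph.fromRel fun a b => (a, b) ∈ instEdges EH EG M

/-! ### Parity of edges in short closed walks -/

/-- The parity of the number of times a walk traverses a bridge
is determined by the sides of the bridge on which its end points lie. -/
lemma count_bridge_eq_indicator {V : Type} [DecidableEq V] {A : SimpleGraph V} {a b : V}
    (hbr : A.IsBridge s(a, b)) (σ : V → ZMod 2)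
    (hσ₁ : ∀ x, (A.deleteEdges {s(a, b)}).Reachable a x → σ x = 1)
    (hσ₀ : ∀ x, ¬ (A.deleteEdges {s(a, b)}).Reachable a x → σ x = 0)
    {u v : V} (p : A.Walk u v) :
    ((p.edges.count s(a, b) : ℕ) : ZMod 2) = σ u + σ v := by
  have hσa : σ a = 1 := hσ₁ a (SimpleGraph.Reachable.refl a)
  have hσb : σ b = 0 := hσ₀ b hbr
  induction p with
  | nil => simp [CharTwo.add_self_eq_zero]
  | @cons x y z hadj q ih =>
    have hstep : (if s(x, y) = s(a, b) then (1 : ZMod 2) else 0) = σ x + σ y := by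
      split_ifs with hxy
      · rcases Sym2.eq_iff.mp hxy with ⟨rfl, rfl⟩ | ⟨rfl, rfl⟩ <;> simp [hσa, hσb]
      · have hadj' : (A.deleteEdges {s(a, b)}).Adj x y := by
          simp [SimpleGraph.deleteEdges_adj, hadj, hxy]
        by_cases hx : (A.deleteEdges {s(a, b)}).Reachable a x
        · rw [hσ₁ x hx, hσ₁ y (hx.trans hadj'.reachable)]
          exact (CharTwo.add_self_eq_zero (1 : ZMod 2)).symm
        · have hy : ¬ (A.deleteEdges {s(a, b)}).Reachable a y := fun hy =>
            hx (hy.trans hadj'.symm.reachable)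
          rw [hσ₀ x hx, hσ₀ y hy, add_zero]
    rw [SimpleGraph.Walk.edges_cons, List.count_cons, Nat.cast_add, ih]
    have hyy := CharTwo.add_self_eq_zero (σ y)
    have : (((if (s(x, y) == s(a, b)) = true then 1 else 0 : ℕ)) : ZMod 2) = σ x + σ y := by
      rw [← hstep]; simp
    rw [this]
    linear_combination hyy

/-- A closed walk shorter than the girth traverses every edge an even number of times. -/
lemma count_edges_closed_of_length_lt_girth {V : Type} [DecidableEq V] {G : SimpleGraph V}
    {g : ℝ} (hg : GirthAtLeast G g) {v : V} (c : G.Walk v v) (hc : (c.length : ℝ) < g)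
    (e : Sym2 V) : ((c.edges.count e : ℕ) : ZMod 2) = 0 := by
  classical
  by_cases he : e ∈ c.edges
  swap
  · simp [List.count_eq_zero_of_not_mem he]
  set A : SimpleGraph V := SimpleGraph.fromEdgeSet {e | e ∈ c.edges} with hA
  have hmem : ∀ e ∈ c.edges, e ∈ A.edgeSet := by
    intro e he
    rw [hA, SimpleGraph.edgeSet_fromEdgeSet]
    exact ⟨he, G.not_isDiag_of_mem_edgeSet (c.edges_subset_edgeSet he)⟩
  have hAmem : ∀ e ∈ A.edgeSet, e ∈ c.edges := by
    intro e he
    rw [hA, SimpleGraph.edgeSet_fromEdgeSet] at he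
    exact he.1
  have hbr : A.IsBridge e := by
    rw [SimpleGraph.isBridge_iff_forall_cycle_notMem (hmem e he)]
    intro u p hp _
    have hpG : ∀ e ∈ p.edges, e ∈ G.edgeSet := fun e he =>
      c.edges_subset_edgeSet (hAmem e (p.edges_subset_edgeSet he))
    have h1 := hg u (p.transfer G hpG) (hp.transfer hpG)
    have h2 : p.length ≤ c.length := by
      rw [← p.length_edges, ← c.length_edges]
      exact (List.subperm_of_subset hp.isTrail.edges_nodup
        (fun e he => hAmem e (p.edges_subset_edgeSet he))).length_le
    rw [SimpleGraph.Walk.length_transfer] at h1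
    have h3 : (p.length : ℝ) ≤ c.length := by exact_mod_cast h2
    linarith
  induction e using Sym2.ind with
  | _ a b =>
    have := count_bridge_eq_indicator hbr
      (fun x => if (A.deleteEdges {s(a, b)}).Reachable a x then 1 else 0)
      (fun x hx => if_pos hx) (fun x hx => if_neg hx) (c.transfer A hmem)
    rw [SimpleGraph.Walk.edges_transfer] at this
    rw [this, CharTwo.add_self_eq_zero]

/-- The parity of the combined multiset along a walk, when the parity of the walk assigned to
each edge differs from that of the edge by a coboundary. -/
lemma count_combinedEdges {V : Type} [DecidableEq V] {G : SimpleGraph V} {G' : G.Subgraph}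
    (Q : ∀ {a b : V}, G'.Adj a b → Multiset (Sym2 V)) (e : Sym2 V) (r : V → ZMod 2)
    (hQ : ∀ {a b : V} (hab : G'.Adj a b),
      (((Q hab).count e : ℕ) : ZMod 2) = r a + r b + if s(a, b) = e then 1 else 0)
    {u v : V} (c : G.Walk u v) (hmem : ∀ e ∈ c.edges, e ∈ G'.edgeSet) :
    (((combinedEdges Q c hmem).count e : ℕ) : ZMod 2) = r u + r v + (c.edges.count e : ℕ) := by
  induction c with
  | nil => simp [combinedEdges, CharTwo.add_self_eq_zero]
  | @cons x y z hadj q ih =>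
    rw [combinedEdges, Multiset.count_add, Nat.cast_add, hQ, ih, SimpleGraph.Walk.edges_cons,
      List.count_cons, Nat.cast_add]
    have hyy := CharTwo.add_self_eq_zero (r y)
    have : (((if (s(x, y) == e) = true then 1 else 0 : ℕ)) : ZMod 2)
        = if s(x, y) = e then 1 else 0 := by simp
    rw [this]
    linear_combination hyy

/-- If the walk assigned to each edge closes up to a walk shorter than the girth when joined with
fixed walks `u ⤳ φ u`, then the assignment is a cycle-homeomorphism. -/
lemma isCycleHomeo_of_short {V : Type} [DecidableEq V] {G : SimpleGraph V} {G' : G.Subgraph}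
    {g : ℝ} (hg : GirthAtLeast G g) (φ : V → V) (R : ∀ v, G.Walk v (φ v))
    (Q : ∀ {a b : V}, G'.Adj a b → Multiset (Sym2 V))
    (hQ : ∀ {a b : V}, ∀ hab : G'.Adj a b, ∃ q : G.Walk (φ a) (φ b),
      (q.edges : Multiset (Sym2 V)) = Q hab ∧
        ((R a).length : ℝ) + q.length + (R b).length + 1 < g) :
    IsCycleHomeo G' Q := by
  intro v c hc hmem
  ext e
  have key : (((combinedEdges Q c hmem).count e : ℕ) : ZMod 2) = (c.edges.count e : ℕ) := by
    rw [count_combinedEdges Q e (fun v => (((R v).edges.count e : ℕ) : ZMod 2)) ?_ c hmem,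
      CharTwo.add_self_eq_zero, zero_add]
    intro a b hab
    obtain ⟨q, hq, hlen⟩ := hQ hab
    have h0 := count_edges_closed_of_length_lt_girth hg
      (((R a).append (q.append (R b).reverse)).append (SimpleGraph.Walk.cons hab.adj_sub.symm .nil))
      (by simp only [SimpleGraph.Walk.length_append, SimpleGraph.Walk.length_reverse,
            SimpleGraph.Walk.length_cons, SimpleGraph.Walk.length_nil]
          push_cast
          linarith) e
    rw [← hq, Multiset.coe_count]
    simp only [SimpleGraph.Walk.edges_append, SimpleGraph.Walk.edges_reverse, List.count_append,
      List.count_reverse, SimpleGraph.Walk.edges_cons, SimpleGraph.Walk.edges_nil,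
      List.count_cons, List.count_nil, Nat.cast_add, beq_iff_eq, Sym2.eq_swap (a := b)] at h0
    have hx := CharTwo.add_self_eq_zero (((R a).edges.count e : ℕ) : ZMod 2)
    have hy := CharTwo.add_self_eq_zero (((R b).edges.count e : ℕ) : ZMod 2)
    have hz := CharTwo.add_self_eq_zero (if s(a, b) = e then (1 : ZMod 2) else 0)
    push_cast at h0
    linear_combination h0 - hx - hy - hz
  simp only [Set.mem_ofPred_eq]
  rw [← ZMod.natCast_eq_one_iff_odd, key]
  by_cases he : e ∈ c.edges
  · simp [List.count_eq_one_of_mem hc.isTrail.edges_nodup he, he]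
  · simp [List.count_eq_zero_of_not_mem he, he]

/-! ### Shortest paths -/

lemma walkCost_cons {V : Type} {Gr : SimpleGraph V} (ℓ : Sym2 V → ℝ) {u v w : V}
    (hadj : Gr.Adj u v) (p : Gr.Walk v w) :
    walkCost ℓ (SimpleGraph.Walk.cons hadj p) = ℓ s(u, v) + walkCost ℓ p := by
  simp [walkCost]

lemma walkCost_nonneg {V : Type} {Gr : SimpleGraph V} {ℓ : Sym2 V → ℝ} (hℓ : ∀ e, 0 ≤ ℓ e)
    {u v : V} (p : Gr.Walk u v) : 0 ≤ walkCost ℓ p := by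
  refine List.sum_nonneg ?_
  simp only [List.mem_map]
  rintro _ ⟨e, -, rfl⟩
  exact hℓ e

lemma spDist_nonneg {V : Type} (Gr : SimpleGraph V) {ℓ : Sym2 V → ℝ} (hℓ : ∀ e, 0 ≤ ℓ e)
    (u v : V) : 0 ≤ spDist Gr ℓ u v := by
  refine Real.sInf_nonneg ?_
  rintro _ ⟨p, rfl⟩
  exact walkCost_nonneg hℓ p

lemma spDist_self {V : Type} (Gr : SimpleGraph V) {ℓ : Sym2 V → ℝ} (hℓ : ∀ e, 0 ≤ ℓ e)
    (u : V) : spDist Gr ℓ u u = 0 := by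
  refine le_antisymm (csInf_le ⟨0, ?_⟩ ⟨SimpleGraph.Walk.nil, by simp [walkCost]⟩)
    (spDist_nonneg Gr hℓ u u)
  rintro _ ⟨p, rfl⟩
  exact walkCost_nonneg hℓ p

/-- In a finite graph with nonnegative lengths, the distance of connected vertices is attained. -/
lemma exists_walkCost_eq_spDist {V : Type} [Finite V] {Gr : SimpleGraph V} {ℓ : Sym2 V → ℝ}
    (hℓ : ∀ e, 0 ≤ ℓ e) {u v : V} (huv : Gr.Reachable u v) :
    ∃ p : Gr.Walk u v, walkCost ℓ p = spDist Gr ℓ u v := by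
  classical
  have := Fintype.ofFinite V
  obtain ⟨w⟩ := huv
  have : Nonempty (Gr.Path u v) := ⟨w.toPath⟩
  obtain ⟨p, hp⟩ := Finite.exists_min (fun p : Gr.Path u v => walkCost ℓ (p : Gr.Walk u v))
  refine ⟨p, le_antisymm (le_csInf ⟨_, w, rfl⟩ ?_) (csInf_le ⟨0, ?_⟩ ⟨p, rfl⟩)⟩
  · rintro _ ⟨q, rfl⟩
    refine (hp q.toPath).trans ?_
    refine (q.edges_bypass_sublist_edges.map ℓ).sum_le_sum ?_
    simp only [List.mem_map]
    rintro _ ⟨e, -, rfl⟩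
    exact hℓ e
  · rintro _ ⟨q, rfl⟩
    exact walkCost_nonneg hℓ q

/-! ### The extension graph -/

lemma extLen_nonneg {VG VH : Type} [DecidableEq VG] (n : ℕ) (e : Sym2 (VG × VH)) :
    0 ≤ extLen n e := by
  have := Real.log_natCast_nonneg n
  unfold extLen
  split_ifs <;> positivity

lemma extGraph_adj_cases {VG VH : Type} {G : SimpleGraph VG} {H : SimpleGraph VH}
    {EG : Finset (VG × VG)} (hEG : IsOrientation G EG) {M : VG × VG → VH ≃ VH}
    {x y : VG × VH} (hxy : (ExtGraph H EG M).Adj x y) : x.1 = y.1 ∨ G.Adj x.1 y.1 := by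
  simp only [ExtGraph, SimpleGraph.fromRel_adj, ExtRel] at hxy
  rcases hxy.2 with (h | h) | (h | h)
  · exact .inl h.1
  · exact .inr (hEG.1 _ h.1)
  · exact .inl h.1.symm
  · exact .inr (hEG.1 _ h.1).symm

/-- A walk of the extension graph projects to a walk of `G`. -/
lemma exists_proj_walk {VG VH : Type} [DecidableEq VG] {G : SimpleGraph VG}
    {H : SimpleGraph VH} {EG : Finset (VG × VG)} (hEG : IsOrientation G EG)
    {M : VG × VG → VH ≃ VH} (n : ℕ) {x y : VG × VH} (p : (ExtGraph H EG M).Walk x y) :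
    ∃ q : G.Walk x.1 y.1, (q.edges : Multiset (Sym2 VG)) = projEdges p ∧
      Real.log n ^ ((2 : ℝ) / 3) * q.length ≤ walkCost (extLen n) p := by
  have hL := Real.log_natCast_nonneg n
  induction p with
  | nil => exact ⟨.nil, by simp [projEdges], by simp [walkCost]⟩
  | @cons a b z hadj p ih =>
    obtain ⟨q, hq, hlen⟩ := ih
    rw [walkCost_cons]
    rcases extGraph_adj_cases hEG hadj with hab | hab
    · refine ⟨q.copy hab.symm rfl, ?_, ?_⟩
      · simp only [SimpleGraph.Walk.edges_copy, hq]
        simp [projEdges, hab]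
      · have := extLen_nonneg n s(a, b)
        simp only [SimpleGraph.Walk.length_copy]
        linarith
    · refine ⟨.cons hab q, ?_, ?_⟩
      · rw [SimpleGraph.Walk.edges_cons, ← Multiset.cons_coe, hq]
        simp [projEdges, hab.ne]
      · have : extLen n s(a, b) = Real.log n ^ ((2 : ℝ) / 3) := by
          simp [extLen, hab.ne]
        rw [this, SimpleGraph.Walk.length_cons]
        push_cast
        linarith

lemma extGraph_preconnected {VG VH : Type} {G : SimpleGraph VG} {H : SimpleGraph VH}
    (hG : G.Connected) (hH : H.Connected) {EG : Finset (VG × VG)} (hEG : IsOrientation G EG)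
    (M : VG × VG → VH ≃ VH) (x y : VG × VH) : (ExtGraph H EG M).Reachable x y := by
  have hcloud : ∀ (g : VG) (a b : VH), (ExtGraph H EG M).Reachable (g, a) (g, b) := by
    intro g a b
    obtain ⟨p⟩ := hH.preconnected a b
    induction p with
    | nil => exact .refl _
    | @cons u v w hadj p ih =>
      refine SimpleGraph.Reachable.trans (SimpleGraph.Adj.reachable ?_) ih
      simp [ExtGraph, ExtRel, hadj, hadj.ne]
  have hstep : ∀ (g₁ g₂ : VG), G.Adj g₁ g₂ → ∀ a : VH,
      ∃ b, (ExtGraph H EG M).Reachable (g₁, a) (g₂, b) := by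
    intro g₁ g₂ hadj a
    by_cases hE : (g₁, g₂) ∈ EG
    · refine ⟨M (g₁, g₂) a, SimpleGraph.Adj.reachable ?_⟩
      simp [ExtGraph, ExtRel, hadj.ne, hE]
    · have hE' : (g₂, g₁) ∈ EG := (hEG.2 g₂ g₁ hadj.symm).mpr hE
      refine ⟨(M (g₂, g₁)).symm a, SimpleGraph.Adj.reachable ?_⟩
      simp [ExtGraph, ExtRel, hadj.ne, hE']
  obtain ⟨g₁, a⟩ := x
  obtain ⟨g₂, b⟩ := y
  obtain ⟨p⟩ := hG.preconnected g₁ g₂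
  induction p generalizing a with
  | nil => exact hcloud _ _ _
  | cons hadj p ih =>
    obtain ⟨a', ha'⟩ := hstep _ _ hadj a
    exact ha'.trans (ih a')

/-- `D_X` dominates the distance in `G` of the clouds. -/
lemma dist_le_extDist {VG VH : Type} [DecidableEq VG] [Finite VG] [Finite VH]
    {G : SimpleGraph VG} {H : SimpleGraph VH} (hG : G.Connected) (hH : H.Connected)
    {EG : Finset (VG × VG)} (hEG : IsOrientation G EG) (M : VG × VG → VH ≃ VH) (n : ℕ)
    (x y : VG × VH) :
    Real.log n ^ ((2 : ℝ) / 3) * G.dist x.1 y.1 ≤ extDist n H EG M x y := by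
  have hL := Real.log_natCast_nonneg n
  obtain ⟨p, hp⟩ := exists_walkCost_eq_spDist (extLen_nonneg n)
    (extGraph_preconnected hG hH hEG M x y)
  obtain ⟨q, -, hq⟩ := exists_proj_walk hEG n p
  have : (G.dist x.1 y.1 : ℝ) ≤ q.length := by exact_mod_cast SimpleGraph.dist_le q
  calc _ ≤ Real.log n ^ ((2 : ℝ) / 3) * (q.length : ℝ) := by gcongr
    _ ≤ _ := hq
    _ = _ := hp

/-! ### Cost estimates -/

/-- If every `i` in a subset `B` of `A` has at least `m` indices `j` with `t i j ≥ a`, then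
`|B| · m · a` is a lower bound for the double sum. -/
lemma card_mul_le_sum_sum {ι κ : Type*} {A B : Finset ι} (hBA : B ⊆ A) (J : Finset κ)
    (t : ι → κ → ℝ) (ht : ∀ i ∈ A, ∀ j ∈ J, 0 ≤ t i j) {m a : ℝ} (ha : 0 ≤ a)
    (hm : ∀ i ∈ B, ∃ J' ⊆ J, m ≤ (J'.card : ℝ) ∧ ∀ j ∈ J', a ≤ t i j) :
    (B.card : ℝ) * (m * a) ≤ ∑ i ∈ A, ∑ j ∈ J, t i j := by
  calc (B.card : ℝ) * (m * a) = ∑ i ∈ B, m * a := by rw [sum_const, nsmul_eq_mul]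
    _ ≤ ∑ i ∈ B, ∑ j ∈ J, t i j := by
      refine sum_le_sum fun i hi => ?_
      obtain ⟨J', hJ', hcard, hJa⟩ := hm i hi
      calc m * a ≤ J'.card * a := by gcongr
        _ = ∑ j ∈ J', a := by rw [sum_const, nsmul_eq_mul]
        _ ≤ ∑ j ∈ J', t i j := sum_le_sum hJa
        _ ≤ ∑ j ∈ J, t i j :=
          sum_le_sum_of_subset_of_nonneg hJ' fun j hj _ => ht i (hBA hi) j hj
    _ ≤ _ := sum_le_sum_of_subset_of_nonneg hBA fun i hi _ => sum_nonneg (ht i hi)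

lemma instD_nonneg {VG VH : Type} [DecidableEq VG] [DecidableEq VH] (n : ℕ)
    (H : SimpleGraph VH) (EG : Finset (VG × VG)) (M : VG × VG → VH ≃ VH) (a b : IV VG VH) :
    0 ≤ instD n H EG M a b := by
  have hL := Real.log_natCast_nonneg n
  unfold instD
  split
  · rename_i u v
    have := spDist_nonneg (ExtGraph H EG M) (extLen_nonneg n) u v
    split_ifs
    · exact le_rfl
    · unfold extDist
      linarith
  · exact le_rfl

lemma instW_nonneg {VG VH : Type} [DecidableEq VG] (n : ℕ) (p : IV VG VH × IV VG VH) :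
    0 ≤ instW n p := by
  have hL := Real.log_natCast_nonneg n
  unfold instW
  split
  · split_ifs <;> positivity
  · positivity
  · exact le_rfl

lemma extDist_le_instD {VG VH : Type} [DecidableEq VG] [DecidableEq VH] (n : ℕ)
    (H : SimpleGraph VH) (EG : Finset (VG × VG)) (M : VG × VG → VH ≃ VH) (x y : VG × VH) :
    extDist n H EG M x y ≤ instD n H EG M (Sum.inr x) (Sum.inr y) := by
  have hL := Real.log_natCast_nonneg n
  by_cases hxy : x = y
  · subst hxy
    simp [instD, extDist, spDist_self _ (extLen_nonneg n)]
  · simp only [instD, hxy, if_false]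
    linarith

lemma two_mul_log_le_instD {VG VH : Type} [DecidableEq VG] [DecidableEq VH] (n : ℕ)
    (H : SimpleGraph VH) (EG : Finset (VG × VG)) (M : VG × VG → VH ≃ VH) {x y : VG × VH}
    (hxy : x ≠ y) : 2 * Real.log n ≤ instD n H EG M (Sum.inr x) (Sum.inr y) := by
  have := spDist_nonneg (ExtGraph H EG M) (extLen_nonneg n) x y
  simp only [instD, hxy, if_false, extDist]
  linarith

section Cost

variable {VG VH : Type} [Fintype VG] [Fintype VH] [DecidableEq VG] [DecidableEq VH] (n : ℕ)
  (H : SimpleGraph VH) (EH : Finset (VH × VH)) (EG : Finset (VG × VG)) (M : VG × VG → VH ≃ VH)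
  (f : IV VG VH → IV VG VH)

lemma sum_le_intCost {S : Finset (IV VG VH × IV VG VH)} (hS : S ⊆ instEdges EH EG M) :
    ∑ p ∈ S, instW n p * instD n H EG M (f p.1) (f p.2) ≤ intCost n H EH EG M f :=
  sum_le_sum_of_subset_of_nonneg hS fun _ _ _ =>
    mul_nonneg (instW_nonneg _ _) (instD_nonneg _ _ _ _ _ _)

lemma intra_le_intCost :
    ∑ g : VG, ∑ q ∈ EH, (Real.log n ^ ((1 : ℝ) / 3))⁻¹ *
      instD n H EG M (f (.inl (g, q.1))) (f (.inl (g, q.2))) ≤ intCost n H EH EG M f := by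
  have hsub : ((univ : Finset VG) ×ˢ EH).image (fun p => ((Sum.inl (p.1, p.2.1) : IV VG VH),
      (Sum.inl (p.1, p.2.2) : IV VG VH))) ⊆ instEdges EH EG M :=
    subset_union_left.trans subset_union_left
  refine le_trans (le_of_eq ?_) (sum_le_intCost n H EH EG M f hsub)
  rw [sum_image, sum_product]
  · simp [instW]
  · rintro ⟨a, b, c⟩ - ⟨a', b', c'⟩ - hab
    simp only [Prod.mk.injEq, Sum.inl.injEq] at hab
    simp [hab]

lemma inter_le_intCost (hEG : ∀ p ∈ EG, p.1 ≠ p.2) :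
    ∑ e ∈ EG, ∑ a : VH, (Real.log n ^ ((2 : ℝ) / 3))⁻¹ *
      instD n H EG M (f (.inl (e.1, a))) (f (.inl (e.2, M e a))) ≤ intCost n H EH EG M f := by
  have hsub : (EG ×ˢ (univ : Finset VH)).image (fun p => ((Sum.inl (p.1.1, p.2) : IV VG VH),
      (Sum.inl (p.1.2, M p.1 p.2) : IV VG VH))) ⊆ instEdges EH EG M :=
    subset_union_right.trans subset_union_left
  refine le_trans (le_of_eq ?_) (sum_le_intCost n H EH EG M f hsub)
  rw [sum_image, sum_product]
  · refine sum_congr rfl fun e he => ?_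
    simp [instW, hEG e he]
  · rintro ⟨⟨a, b⟩, c⟩ - ⟨⟨a', b'⟩, c'⟩ - hab
    simp only [Prod.mk.injEq, Sum.inl.injEq] at hab
    simp [hab]

lemma pendant_le_intCost :
    ∑ g : VG, ∑ a : VH, (Real.log n)⁻¹ *
      instD n H EG M (f (.inl (g, a))) (f (.inr (g, a))) ≤ intCost n H EH EG M f := by
  have hsub : (univ : Finset (VG × VH)).image (fun x => ((Sum.inl x : IV VG VH),
      (Sum.inr x : IV VG VH))) ⊆ instEdges EH EG M := subset_union_right
  refine le_trans (le_of_eq ?_) (sum_le_intCost n H EH EG M f hsub)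
  rw [sum_image, ← univ_product_univ, sum_product]
  · simp [instW]
  · rintro x - y - hab
    simp only [Prod.mk.injEq, Sum.inl.injEq] at hab
    exact hab.1

end Cost

/-! ### Expansion -/

/-- In an expander, a map is either constant on three quarters of the vertices, or it separates
a linear number of edges. -/
lemma majority_or_many_cut {V Y : Type} [Fintype V] [DecidableEq Y] {H : SimpleGraph V} {h : ℝ}
    (hh : 0 ≤ h) (hexp : EdgeExpansionAtLeast H h) {EH : Finset (V × V)}
    (hEH : IsOrientation H EH) (φ : V → Y) :
    (∃ y, (3 / 4 : ℝ) * Fintype.card V ≤ (#{v | φ v = y} : ℝ)) ∨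
      h * Fintype.card V / 8 ≤ (#{q ∈ EH | φ q.1 ≠ φ q.2} : ℝ) := by
  classical
  rw [or_iff_not_imp_left]
  intro hno
  push Not at hno
  set cut : Finset (V × V) := {p | H.Adj p.1 p.2 ∧ φ p.1 ≠ φ p.2} with hcut
  have hcut2 : cut.card ≤ 2 * #{q ∈ EH | φ q.1 ≠ φ q.2} := by
    have hsub : cut ⊆ {q ∈ EH | φ q.1 ≠ φ q.2} ∪ ({q ∈ EH | φ q.1 ≠ φ q.2}).image Prod.swap := by
      rintro ⟨a, b⟩ hab
      simp only [hcut, mem_filter, mem_univ, true_and] at hab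
      simp only [mem_union, mem_filter, mem_image, Prod.exists, Prod.swap_prod_mk, Prod.mk.injEq]
      by_cases hE : (a, b) ∈ EH
      · exact .inl ⟨hE, hab.2⟩
      · exact .inr ⟨b, a, ⟨(hEH.2 b a hab.1.symm).mpr hE, hab.2.symm⟩, rfl, rfl⟩
    have h1 := (card_le_card hsub).trans (card_union_le _ _)
    have h2 := card_image_le (s := {q ∈ EH | φ q.1 ≠ φ q.2}) (f := Prod.swap)
    omega
  have hbdry : ∀ S : Finset V, (2 * S.card ≤ Fintype.card V) →
      h * S.card ≤ (#{p : V × V | H.Adj p.1 p.2 ∧ p.1 ∈ S ∧ p.2 ∉ S} : ℝ) := by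
    intro S hS
    have := hexp S hS
    rwa [Set.ncard_eq_toFinset_card', Set.toFinset_ofPred] at this
  suffices h * Fintype.card V / 4 ≤ (cut.card : ℝ) by
    have : (cut.card : ℝ) ≤ 2 * (#{q ∈ EH | φ q.1 ≠ φ q.2} : ℝ) := by exact_mod_cast hcut2
    linarith
  by_cases hbig : ∃ y, Fintype.card V < 2 * #{v | φ v = y}
  · obtain ⟨y, hy⟩ := hbig
    have hcompl : #{v | φ v = y} + #{v | φ v ≠ y} = Fintype.card V := by
      rw [card_filter_add_card_filter_not, card_univ]
    have h1 := hbdry {v | φ v ≠ y} (by omega)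
    have h2 := hno y
    have h3 : ((#{v | φ v = y} : ℕ) : ℝ) + (#{v | φ v ≠ y} : ℕ) = Fintype.card V := by
      exact_mod_cast hcompl
    have h4 : (#{p : V × V | H.Adj p.1 p.2 ∧ p.1 ∈ ({v | φ v ≠ y} : Finset V) ∧
        p.2 ∉ ({v | φ v ≠ y} : Finset V)} : ℝ) ≤ cut.card := by
      norm_cast
      refine card_le_card ?_
      rintro ⟨a, b⟩ hab
      simp only [mem_filter, mem_univ, true_and, not_not, hcut] at hab ⊢
      exact ⟨hab.1, fun h => hab.2.1 (h.trans hab.2.2)⟩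
    nlinarith
  · push Not at hbig
    have hsum : ∑ y ∈ univ.image φ, #{v | φ v = y} = Fintype.card V := by
      rw [← card_univ, card_eq_sum_card_image φ univ]
    have hcutsum : cut.card = ∑ y ∈ univ.image φ, #{p ∈ cut | φ p.1 = y} :=
      card_eq_sum_card_fiberwise fun p _ => by simp
    have : h * Fintype.card V ≤ (cut.card : ℝ) := by
      rw [← hsum, hcutsum]
      push_cast
      rw [mul_sum]
      refine sum_le_sum fun y _ => (hbdry _ (hbig y)).trans ?_
      norm_cast
      refine card_le_card ?_
      rintro ⟨a, b⟩ hab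
      simp only [mem_filter, mem_univ, true_and, hcut] at hab ⊢
      exact ⟨⟨hab.1, fun h => hab.2.2 (h ▸ hab.2.1)⟩, hab.2.1⟩
    have : 0 ≤ h * Fintype.card V := by positivity
    linarith

/-! ### Counting edges through an orientation -/

lemma sym2_injOn_orientation {V : Type} {G : SimpleGraph V} {EG : Finset (V × V)}
    (hEG : IsOrientation G EG) : Set.InjOn (fun p : V × V => s(p.1, p.2)) EG := by
  rintro ⟨a, b⟩ hab ⟨c, e⟩ hce heq
  rcases Sym2.eq_iff.mp heq with ⟨h1, h2⟩ | ⟨h1, h2⟩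
  · exact Prod.ext h1 h2
  · simp only at h1 h2
    subst h1 h2
    exact absurd hce ((hEG.2 _ _ (hEG.1 _ hab)).mp hab)

lemma ncard_edgeSet_le_card_orientation {V : Type} {G : SimpleGraph V} {EG : Finset (V × V)}
    (hEG : IsOrientation G EG) : G.edgeSet.ncard ≤ EG.card := by
  have hsub : G.edgeSet ⊆ (fun p : V × V => s(p.1, p.2)) '' EG := by
    intro e he
    induction e using Sym2.ind with
    | _ a b =>
      by_cases hE : (a, b) ∈ EG
      · exact ⟨(a, b), hE, rfl⟩
      · exact ⟨(b, a), (hEG.2 b a (G.mem_edgeSet.mp he).symm).mpr hE, Sym2.eq_swap⟩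
  calc G.edgeSet.ncard ≤ ((fun p : V × V => s(p.1, p.2)) '' EG).ncard :=
        Set.ncard_le_ncard hsub (EG.finite_toSet.image _)
    _ ≤ (EG : Set (V × V)).ncard := Set.ncard_image_le EG.finite_toSet
    _ = EG.card := Set.ncard_coe_finset EG

lemma card_le_ncard_subgraph_edgeSet {V : Type} [Finite V] {G : SimpleGraph V}
    {EG : Finset (V × V)} (hEG : IsOrientation G EG) {G' : G.Subgraph} {S : Finset (V × V)}
    (hS : S ⊆ EG) (hadj : ∀ p ∈ S, G'.Adj p.1 p.2) : S.card ≤ G'.edgeSet.ncard := by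
  rw [← Set.ncard_coe_finset,
    ← ((sym2_injOn_orientation hEG).mono (Finset.coe_subset.mpr hS)).ncard_image]
  refine Set.ncard_le_ncard ?_ (Set.toFinite _)
  rintro _ ⟨p, hp, rfl⟩
  exact hadj p hp

lemma mul_card_le_two_mul_card_orientation {V : Type} [Fintype V] {G : SimpleGraph V}
    {EG : Finset (V × V)} (hEG : IsOrientation G EG) {d : ℕ}
    (hd : ∀ v, (G.neighborSet v).ncard = d) : d * Fintype.card V ≤ 2 * EG.card := by
  classical
  have hcard : #{p : V × V | G.Adj p.1 p.2} = d * Fintype.card V := by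
    rw [card_eq_sum_card_fiberwise (f := Prod.fst) (t := univ) fun p _ => by simp]
    rw [sum_congr rfl (g := fun _ => d), sum_const, card_univ, smul_eq_mul, mul_comm]
    intro v _
    rw [← hd v, Set.ncard_eq_toFinset_card']
    refine card_bij' (fun p _ => p.2) (fun w _ => (v, w)) ?_ ?_ ?_ ?_
    · rintro ⟨a, b⟩ hab
      simp only [mem_filter, mem_univ, true_and] at hab
      simpa [← hab.2] using hab.1
    · intro w hw
      simpa using hw
    · rintro ⟨a, b⟩ hab
      simp only [mem_filter, mem_univ, true_and] at hab
      simp [hab.2]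
    · simp
  have hsub : ({p : V × V | G.Adj p.1 p.2} : Finset (V × V)) ⊆ EG ∪ EG.image Prod.swap := by
    rintro ⟨a, b⟩ hab
    simp only [mem_filter, mem_univ, true_and] at hab
    simp only [mem_union, mem_image, Prod.exists, Prod.swap_prod_mk, Prod.mk.injEq]
    by_cases hE : (a, b) ∈ EG
    · exact .inl hE
    · exact .inr ⟨b, a, (hEG.2 b a hab.symm).mpr hE, rfl, rfl⟩
  have h1 := (card_le_card hsub).trans (card_union_le _ _)
  have h2 := card_image_le (s := EG) (f := Prod.swap)
  omega

/-- At most `2 * d * |B|` oriented edges touch a set `B`. -/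
lemma card_incident_le {V : Type} [Fintype V] [DecidableEq V] {G : SimpleGraph V}
    {EG : Finset (V × V)} (hEG : IsOrientation G EG) {d : ℕ}
    (hd : ∀ v, (G.neighborSet v).ncard = d) (B : Finset V) :
    #{p ∈ EG | p.1 ∈ B ∨ p.2 ∈ B} ≤ 2 * (d * B.card) := by
  classical
  have hfst : #{p ∈ EG | p.1 ∈ B} ≤ d * B.card := by
    refine card_le_mul_card_image_of_maps_to (f := Prod.fst) (by simp) d ?_
    intro v _
    rw [← hd v, ← Set.ncard_coe_finset]
    refine Set.ncard_le_ncard_of_injOn Prod.snd ?_ ?_ (Set.toFinite _)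
    · rintro ⟨a, b⟩ hab
      simp only [coe_filter, mem_filter, Set.mem_ofPred_eq] at hab
      simpa [← hab.2] using hEG.1 _ hab.1.1
    · rintro ⟨a, b⟩ hab ⟨a', b'⟩ hab' hbb
      simp only [coe_filter, mem_filter, Set.mem_ofPred_eq] at hab hab' hbb
      simp [hab.2, hab'.2, hbb]
  have hsnd : #{p ∈ EG | p.2 ∈ B} ≤ d * B.card := by
    refine card_le_mul_card_image_of_maps_to (f := Prod.snd) (by simp) d ?_
    intro v _
    rw [← hd v, ← Set.ncard_coe_finset]
    refine Set.ncard_le_ncard_of_injOn Prod.fst ?_ ?_ (Set.toFinite _)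
    · rintro ⟨a, b⟩ hab
      simp only [coe_filter, mem_filter, Set.mem_ofPred_eq] at hab
      simpa [← hab.2] using (hEG.1 _ hab.1.1).symm
    · rintro ⟨a, b⟩ hab ⟨a', b'⟩ hab' hbb
      simp only [coe_filter, mem_filter, Set.mem_ofPred_eq] at hab hab' hbb
      simp [hab.2, hab'.2, hbb]
  rw [filter_or]
  have := card_union_le {p ∈ EG | p.1 ∈ B} {p ∈ EG | p.2 ∈ B}
  omega

lemma spDist_comm {V : Type} (Gr : SimpleGraph V) (ℓ : Sym2 V → ℝ) (u v : V) :
    spDist Gr ℓ u v = spDist Gr ℓ v u := by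
  have hrev : ∀ {a b : V} (p : Gr.Walk a b), walkCost ℓ p.reverse = walkCost ℓ p := by
    intro a b p
    simp [walkCost, List.sum_reverse]
  unfold spDist
  congr 1
  ext r
  constructor <;> rintro ⟨p, rfl⟩ <;> exact ⟨p.reverse, (hrev p).symm⟩

/-! ### Rounding an integral solution -/

/-- A cheap integral solution is, on most clouds, nearly constant with a nearby value, and these
values are close for most edges of `G`. -/
lemma exists_rounding {d : ℕ} (hd : 3 ≤ d) {h ε c : ℝ} (hh : 0 < h) (hε : 0 < ε) (hε1 : ε ≤ 1)
    (hc1 : c ≤ h / 64) (hc2 : c ≤ 1 / 16) {n : ℕ} (hn : 0 < n) (hL : 0 < Real.log n)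
    {VG VH : Type} [Fintype VG] [Fintype VH] [DecidableEq VG] [DecidableEq VH]
    {G : SimpleGraph VG} {H : SimpleGraph VH} (hVG : Fintype.card VG = n)
    (hVH : Fintype.card VH = n) (hG : G.Connected) (hH : H.Connected)
    (hdG : ∀ v, (G.neighborSet v).ncard = d) (hexp : EdgeExpansionAtLeast H h)
    {EG : Finset (VG × VG)} (hEG : IsOrientation G EG)
    {EH : Finset (VH × VH)} (hEH : IsOrientation H EH) (M : VG × VG → VH ≃ VH)
    {f : IV VG VH → IV VG VH} (hf : IsIntegralSolution f)
    (hcost : intCost n H EH EG M f ≤ c * ε ^ 2 * (n : ℝ) ^ 2 * Real.log n ^ ((2 : ℝ) / 3)) :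
    ∃ (fbar : VG → VG × VH) (B : Finset VG) (S : Finset (VG × VG)), S ⊆ EG ∧
      (1 - ε) * (EG.card : ℝ) ≤ S.card ∧
      (∀ g ∉ B, (G.dist g (fbar g).1 : ℝ) ≤ ε * Real.log n) ∧
      ∀ p ∈ S, p.1 ∉ B ∧ p.2 ∉ B ∧
        extDist n H EG M (fbar p.1) (fbar p.2) < ε * Real.log n ^ ((4 : ℝ) / 3) := by
  classical
  choose F hF using fun x : VG × VH => hf.1 (.inl x)
  have hterm := hf.2
  set L := Real.log n with hLdef
  set lam := L ^ ((2 : ℝ) / 3) with hlam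
  have hlam0 : 0 < lam := by positivity
  have hn0 : (0 : ℝ) < n := by exact_mod_cast hn
  have h43 : L ^ ((4 : ℝ) / 3) = lam * lam := by
    rw [hlam, ← Real.rpow_add hL]; norm_num
  have h13 : (L ^ ((1 : ℝ) / 3))⁻¹ * L = lam := by
    rw [← Real.rpow_neg hL.le]
    nth_rewrite 2 [← Real.rpow_one L]
    rw [← Real.rpow_add hL]; norm_num [hlam]
  set maj : VG → VG × VH → Prop := fun g y => (3 / 4 : ℝ) * n ≤ (#{a : VH | F (g, a) = y} : ℝ)
    with hmaj
  obtain ⟨fbar, hfbar⟩ : ∃ fbar : VG → VG × VH, ∀ g, (∃ y, maj g y) → maj g (fbar g) := by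
    have hne : Nonempty VH := hH.nonempty
    have : ∀ g, ∃ y, (∃ y, maj g y) → maj g y := by
      intro g
      by_cases hg : ∃ y, maj g y
      · obtain ⟨y, hy⟩ := hg
        exact ⟨y, fun _ => hy⟩
      · exact ⟨(g, hne.some), fun h => absurd h hg⟩
    choose fbar hfbar using this
    exact ⟨fbar, hfbar⟩
  set B₁ : Finset VG := {g | ¬ maj g (fbar g)} with hB₁
  set B₂ : Finset VG := {g | maj g (fbar g) ∧ ¬ (G.dist g (fbar g).1 : ℝ) ≤ ε * L} with hB₂
  set B₃ : Finset (VG × VG) := {p ∈ EG | maj p.1 (fbar p.1) ∧ maj p.2 (fbar p.2) ∧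
    ¬ extDist n H EG M (fbar p.1) (fbar p.2) < ε * L ^ ((4 : ℝ) / 3)} with hB₃
  have hD0 := instD_nonneg n H EG M
  -- clouds without a majority value
  have hcard₁ : (B₁.card : ℝ) ≤ ε * n / 16 := by
    have key := (card_mul_le_sum_sum (subset_univ B₁) EH (fun g q => (L ^ ((1 : ℝ) / 3))⁻¹ *
      instD n H EG M (f (.inl (g, q.1))) (f (.inl (g, q.2)))) (m := h * n / 8) (a := 2 * lam)
      (fun g _ q _ => mul_nonneg (by positivity) (hD0 _ _)) (by positivity) ?_).trans
      ((intra_le_intCost n H EH EG M f).trans hcost)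
    · have h1 : (B₁.card : ℝ) * (h / 4) * (n * lam) ≤ c * ε ^ 2 * n * (n * lam) := by
        calc _ = (B₁.card : ℝ) * (h * n / 8 * (2 * lam)) := by ring
          _ ≤ _ := key
          _ = _ := by ring
      have h2 : (B₁.card : ℝ) * (h / 4) ≤ c * ε ^ 2 * n := le_of_mul_le_mul_right h1 (by positivity)
      have h3 : c * ε ^ 2 * n ≤ h / 64 * ε * n := by
        have : ε ^ 2 ≤ ε := by nlinarith
        gcongr
      have h4 : (B₁.card : ℝ) * (h / 4) ≤ ε * n / 16 * (h / 4) := by linarith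
      exact le_of_mul_le_mul_right h4 (by positivity)
    · intro g hg
      have hnot : ¬ ∃ y, maj g y := fun hy => (mem_filter.mp hg).2 (hfbar g hy)
      rcases majority_or_many_cut hh.le hexp hEH (fun a => F (g, a)) with ⟨y, hy⟩ | hcut
      · rw [hVH] at hy
        exact absurd ⟨y, hy⟩ hnot
      · rw [hVH] at hcut
        refine ⟨_, filter_subset _ _, hcut, ?_⟩
        intro q hq
        have h1 := two_mul_log_le_instD n H EG M (mem_filter.mp hq).2
        rw [hF, hF, ← h13]
        have h2 : 0 ≤ (L ^ ((1 : ℝ) / 3))⁻¹ := by positivity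
        nlinarith [mul_le_mul_of_nonneg_left h1 h2]
  -- clouds whose majority value is far away
  have hcard₂ : (B₂.card : ℝ) ≤ ε * n / 12 := by
    have key := (card_mul_le_sum_sum (subset_univ B₂) (univ : Finset VH) (fun g a => L⁻¹ *
      instD n H EG M (f (.inl (g, a))) (f (.inr (g, a)))) (m := 3 / 4 * n) (a := ε * lam)
      (fun g _ q _ => mul_nonneg (by positivity) (hD0 _ _)) (by positivity) ?_).trans
      ((pendant_le_intCost n H EH EG M f).trans hcost)
    · have h1 : (B₂.card : ℝ) * (3 / 4) * (n * ε * lam) ≤ c * ε * n * (n * ε * lam) := by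
        calc _ = (B₂.card : ℝ) * (3 / 4 * n * (ε * lam)) := by ring
          _ ≤ _ := key
          _ = _ := by ring
      have h2 := le_of_mul_le_mul_right h1 (by positivity)
      have h3 : c * ε * n ≤ 1 / 16 * ε * n := by gcongr
      linarith
    · intro g hg
      obtain ⟨hg1, hg2⟩ := (mem_filter.mp hg).2
      refine ⟨_, filter_subset _ _, hg1, ?_⟩
      intro a ha
      rw [hF, hterm, (mem_filter.mp ha).2]
      have h1 := dist_le_extDist hG hH hEG M n (fbar g) (g, a)
      have h2 := extDist_le_instD n H EG M (fbar g) (g, a)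
      rw [SimpleGraph.dist_comm] at h1
      push Not at hg2
      have h3 : lam * (ε * L) ≤ lam * (G.dist g (fbar g).1 : ℝ) := by gcongr
      rw [le_inv_mul_iff₀ hL]
      calc L * (ε * lam) = lam * (ε * L) := by ring
        _ ≤ _ := h3.trans (h1.trans h2)
  -- edges whose majority values are far apart
  have hcard₃ : (B₃.card : ℝ) ≤ ε * n / 8 := by
    have key := (card_mul_le_sum_sum (filter_subset _ EG : B₃ ⊆ EG) (univ : Finset VH)
      (fun e a => lam⁻¹ * instD n H EG M (f (.inl (e.1, a))) (f (.inl (e.2, M e a))))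
      (m := n / 2) (a := ε * lam)
      (fun g _ q _ => mul_nonneg (by positivity) (hD0 _ _)) (by positivity) ?_).trans
      ((inter_le_intCost n H EH EG M f fun p hp => (hEG.1 p hp).ne).trans hcost)
    · have h1 : (B₃.card : ℝ) * (1 / 2) * (n * ε * lam) ≤ c * ε * n * (n * ε * lam) := by
        calc _ = (B₃.card : ℝ) * (n / 2 * (ε * lam)) := by ring
          _ ≤ _ := key
          _ = _ := by ring
      have h2 := le_of_mul_le_mul_right h1 (by positivity)
      have h3 : c * ε * n ≤ 1 / 16 * ε * n := by gcongr
      linarith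
    · intro e he
      obtain ⟨-, he1, he2, he3⟩ := mem_filter.mp he
      refine ⟨({a | F (e.1, a) = fbar e.1} : Finset VH) ∩
        ({a | F (e.2, M e a) = fbar e.2} : Finset VH), subset_univ _, ?_, ?_⟩
      · have hbij : #{a | F (e.2, M e a) = fbar e.2} = #{a | F (e.2, a) = fbar e.2} :=
          card_equiv (M e) (by simp)
        have h1 := card_union_add_card_inter ({a | F (e.1, a) = fbar e.1} : Finset VH)
          ({a | F (e.2, M e a) = fbar e.2} : Finset VH)
        have h2 := card_le_univ (({a | F (e.1, a) = fbar e.1} : Finset VH) ∪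
          ({a | F (e.2, M e a) = fbar e.2} : Finset VH))
        rw [hVH] at h2
        rw [hbij] at h1
        simp only [hmaj] at he1 he2
        have h1' := congrArg (Nat.cast : ℕ → ℝ) h1
        push_cast at h1'
        have h2' : ((#(({a | F (e.1, a) = fbar e.1} : Finset VH) ∪
          ({a | F (e.2, M e a) = fbar e.2} : Finset VH)) : ℕ) : ℝ) ≤ n := by exact_mod_cast h2
        linarith
      · intro a ha
        simp only [mem_inter, mem_filter, mem_univ, true_and] at ha
        rw [hF, hF, ha.1, ha.2]
        have h2 := extDist_le_instD n H EG M (fbar e.1) (fbar e.2)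
        push Not at he3
        rw [le_inv_mul_iff₀ hlam0]
        calc lam * (ε * lam) = ε * L ^ ((4 : ℝ) / 3) := by rw [h43]; ring
          _ ≤ _ := he3.trans h2
  set B := B₁ ∪ B₂ with hB
  have hBmem : ∀ g ∉ B, maj g (fbar g) ∧ (G.dist g (fbar g).1 : ℝ) ≤ ε * L := by
    intro g hg
    simp only [hB, hB₁, hB₂, mem_union, mem_filter, mem_univ, true_and, not_or, not_and,
      not_not] at hg
    exact ⟨hg.1, hg.2 hg.1⟩
  set S : Finset (VG × VG) := {p ∈ EG | p.1 ∉ B ∧ p.2 ∉ B ∧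
    extDist n H EG M (fbar p.1) (fbar p.2) < ε * L ^ ((4 : ℝ) / 3)} with hS
  refine ⟨fbar, B, S, filter_subset _ _, ?_, fun g hg => (hBmem g hg).2,
    fun p hp => (mem_filter.mp hp).2⟩
  have hcover : EG ⊆ S ∪ ({p ∈ EG | p.1 ∈ B ∨ p.2 ∈ B} ∪ B₃) := by
    intro p hp
    by_cases h1 : p.1 ∈ B
    · exact mem_union_right _ (mem_union_left _ (mem_filter.mpr ⟨hp, .inl h1⟩))
    by_cases h2 : p.2 ∈ B
    · exact mem_union_right _ (mem_union_left _ (mem_filter.mpr ⟨hp, .inr h2⟩))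
    by_cases h3 : extDist n H EG M (fbar p.1) (fbar p.2) < ε * L ^ ((4 : ℝ) / 3)
    · exact mem_union_left _ (mem_filter.mpr ⟨hp, h1, h2, h3⟩)
    · exact mem_union_right _ (mem_union_right _
        (mem_filter.mpr ⟨hp, (hBmem _ h1).1, (hBmem _ h2).1, h3⟩))
  have hcount : EG.card ≤ S.card + (2 * (d * (B₁.card + B₂.card)) + B₃.card) := by
    have h1 := (card_le_card hcover).trans (card_union_le _ _)
    have h2 := card_union_le {p ∈ EG | p.1 ∈ B ∨ p.2 ∈ B} B₃
    have h3 := card_incident_le hEG hdG B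
    have h4 : d * B.card ≤ d * (B₁.card + B₂.card) := Nat.mul_le_mul_left d (card_union_le _ _)
    omega
  have hcount' : (EG.card : ℝ) ≤ S.card + (2 * (d * (B₁.card + B₂.card)) + B₃.card) := by
    exact_mod_cast hcount
  have hEGcard : (d : ℝ) * n ≤ 2 * EG.card := by
    rw [← hVG]
    exact_mod_cast mul_card_le_two_mul_card_orientation hEG hdG
  have hd' : (3 : ℝ) ≤ d := by exact_mod_cast hd
  have h1 : (d : ℝ) * (B₁.card + B₂.card) ≤ d * (ε * n / 16 + ε * n / 12) := by gcongr
  have h2 : ε * (d * n) ≤ ε * (2 * EG.card) := by gcongr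
  have h3 : 3 * (ε * n) ≤ d * (ε * n) := by gcongr
  nlinarith

/-- Cheap integral solutions yield splits: for `d ≥ 3` and `h, γ > 0` there are constants
`c > 0` and `ε₀ > 0` (depending only on `d, h, γ`) such that for every `ε ∈ (0, ε₀)` and
every sufficiently large `n`, for every pair `(G, H)` satisfying the hypotheses, every
orientation of their edges, every family `M` of bijections, and every integral solution
`f` of `𝓘(X(G,H,M))` of cost at most `c·ε²·n²·(log n)^{2/3}`, there is a map `f̄` which
is an `(ε·(log n)^{4/3}, ε)`-split. -/
theorem cheap_integral_gives_split (d : ℕ) (hd : 3 ≤ d) (h γ : ℝ) (hh : 0 < h)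
    (hγ : 0 < γ) :
    ∃ c : ℝ, 0 < c ∧ ∃ ε₀ : ℝ, 0 < ε₀ ∧
      ∀ ε : ℝ, 0 < ε → ε < ε₀ →
      ∃ N : ℕ, ∀ n : ℕ, N ≤ n →
        ∀ (VG VH : Type) [Fintype VG] [Fintype VH] [DecidableEq VG] [DecidableEq VH]
          [Group VG] [Group VH] (G : SimpleGraph VG) (H : SimpleGraph VH),
          GoodPair d h γ n G H →
          ∀ EG : Finset (VG × VG), IsOrientation G EG →
          ∀ EH : Finset (VH × VH), IsOrientation H EH →
          ∀ M : VG × VG → VH ≃ VH,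
          ∀ f : IV VG VH → IV VG VH, IsIntegralSolution f →
            intCost n H EH EG M f ≤ c * ε ^ 2 * (n : ℝ) ^ 2 * Real.log n ^ ((2 : ℝ) / 3) →
            ∃ (G' : G.Subgraph) (fbar : VG → VG × VH),
              IsSplit n G H EG M (ε * Real.log n ^ ((4 : ℝ) / 3)) ε G' fbar := by
  refine ⟨min (h / 64) (1 / 16), by positivity, min 1 (γ / 8), by positivity, ?_⟩
  intro ε hε hεlt
  have hε1 : ε ≤ 1 := hεlt.le.trans (min_le_left _ _)
  have hεγ : ε ≤ γ / 8 := hεlt.le.trans (min_le_right _ _)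
  refine ⟨⌈Real.exp (1 + 2 / γ)⌉₊ + 1, ?_⟩
  intro n hn VG VH _ _ _ _ _ _ G H hGH EG hEG EH hEH M f hf hcost
  obtain ⟨hVG, hVH, hG, hH, hdG, -, -, -, -, hexpH, hgirth, -⟩ := hGH
  have hexpn : Real.exp (1 + 2 / γ) < n := by
    calc Real.exp (1 + 2 / γ) ≤ ⌈Real.exp (1 + 2 / γ)⌉₊ := Nat.le_ceil _
      _ < n := by exact_mod_cast hn
  have hn0 : (0 : ℝ) < n := (Real.exp_pos _).trans hexpn
  have hLbig : 1 + 2 / γ < Real.log n := (Real.lt_log_iff_exp_lt hn0).mpr hexpn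
  have hγ2 : 0 < 2 / γ := by positivity
  have hL1 : 1 ≤ Real.log n := by linarith
  have hLγ : 2 < γ * Real.log n := by
    have : 2 / γ < Real.log n := by linarith
    rwa [div_lt_iff₀' hγ] at this
  obtain ⟨fbar, B, S, hS, hScard, hBdist, hSprop⟩ := exists_rounding hd hh hε hε1
    (min_le_left _ _) (min_le_right _ _) (by exact_mod_cast hn0) (by linarith) hVG hVH hG hH hdG
    hexpH hEG hEH M hf hcost
  set G' : G.Subgraph :=
    { verts := {g | g ∉ B}
      Adj := fun a b => G.Adj a b ∧ a ∉ B ∧ b ∉ B ∧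
        extDist n H EG M (fbar a) (fbar b) < ε * Real.log n ^ ((4 : ℝ) / 3)
      adj_sub := fun hab => hab.1
      edge_vert := fun hab => hab.2.1
      symm := ⟨fun a b hab => ⟨hab.1.symm, hab.2.2.1, hab.2.1, by
        rw [extDist, spDist_comm]; exact hab.2.2.2⟩⟩ } with hG'
  refine ⟨G', fbar, ?_, ?_, fun hab => hab.2.2.2, fun g hg => hBdist g hg⟩
  · have h1 : (G.edgeSet.ncard : ℝ) ≤ EG.card := by
      exact_mod_cast ncard_edgeSet_le_card_orientation hEG
    have h2 : (S.card : ℝ) ≤ G'.edgeSet.ncard := by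
      exact_mod_cast card_le_ncard_subgraph_edgeSet (G' := G') hEG hS
        fun p hp => ⟨hEG.1 p (hS hp), hSprop p hp⟩
    have h3 : 0 ≤ 1 - ε := by linarith
    calc (1 - ε) * (G.edgeSet.ncard : ℝ) ≤ (1 - ε) * EG.card := by gcongr
      _ ≤ _ := hScard.trans h2
  · choose P hP using fun a b : VG => exists_walkCost_eq_spDist (extLen_nonneg n)
      (extGraph_preconnected hG hH hEG M (fbar a) (fbar b))
    choose R hR using fun a : VG => hG.exists_walk_length_eq_dist a (fbar a).1
    refine ⟨fun {a b} _ => P a b, fun {a b} _ => hP a b, ?_⟩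
    refine isCycleHomeo_of_short hgirth (fun a => (fbar a).1) R _ ?_
    intro a b hab
    obtain ⟨q, hq, hqlen⟩ := exists_proj_walk hEG n (P a b)
    refine ⟨q, hq, ?_⟩
    obtain ⟨-, ha, hb, hdist⟩ := hab
    set lam := Real.log n ^ ((2 : ℝ) / 3) with hlam
    have hlam0 : 0 < lam := by positivity
    have hlamL : lam ≤ Real.log n := by
      calc lam ≤ Real.log n ^ (1 : ℝ) := Real.rpow_le_rpow_of_exponent_le hL1 (by norm_num)
        _ = Real.log n := Real.rpow_one _
    have h43 : Real.log n ^ ((4 : ℝ) / 3) = lam * lam := by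
      rw [hlam, ← Real.rpow_add (by linarith)]; norm_num
    have hqlt : (q.length : ℝ) < ε * lam := by
      refine lt_of_mul_lt_mul_left ?_ hlam0.le
      calc lam * (q.length : ℝ) ≤ extDist n H EG M (fbar a) (fbar b) := hqlen.trans (hP a b).le
        _ < ε * Real.log n ^ ((4 : ℝ) / 3) := hdist
        _ = lam * (ε * lam) := by rw [h43]; ring
    have hRa := hBdist a ha
    have hRb := hBdist b hb
    rw [← hR] at hRa hRb
    have h1 : ε * lam ≤ ε * Real.log n := by gcongr
    have h2 : ε * Real.log n ≤ γ / 8 * Real.log n := by gcongr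
    linarith
end
end

section
/- Fix an integer d ≥ 3 and reals h,γ > 0. There exists ε₀ > 0 (depending only on d, h, γ) such that for every ε ∈ (0,ε₀) and every sufficiently large n (depending on ε), for every pair of graphs G, H on n vertices satisfying the hypotheses, there exists a family M of bijections (equivalently, with nonzero probability over the independent uniform random choice of the bijections M_e) such that the extension graph X(G,H,M) admits no map f̄ that is an (ε·(log n)^{4/3}, ε)-split. -/
open Finset

noncomputable section

variable {VG VH : Type}

/-- The family `M` of bijections realises every triple `(e, x, y)` of `R`: `M e x = y`. -/
def Realises {ι β : Type} (R : Finset (ι × β × β)) (M : ι → β ≃ β) : Prop :=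
  ∀ t ∈ R, M t.1 t.2.1 = t.2.2

open Classical in
theorem card_realises_insert {ι β : Type} [Fintype ι] [Fintype β] [DecidableEq ι] [DecidableEq β]
    (R : Finset (ι × β × β)) (t : ι × β × β) (ht : t ∉ R)
    (hR : 2 * #{s ∈ R | s.1 = t.1} ≤ Fintype.card β) :
    (#{M : ι → β ≃ β | Realises (insert t R) M} : ℝ) * ((Fintype.card β : ℝ) / 2) ≤
      #{M : ι → β ≃ β | Realises R M} := by
  obtain ⟨e, x, y⟩ := t
  set Y : Finset β := univ \ ({s ∈ R | s.1 = e}).image (fun s => s.2.2) with hY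
  have hYc : (Fintype.card β : ℝ) / 2 ≤ #Y := by
    have h1 : #(({s ∈ R | s.1 = e}).image (fun s => s.2.2)) ≤ #{s ∈ R | s.1 = e} := card_image_le
    have h2 : #Y + #(({s ∈ R | s.1 = e}).image (fun s => s.2.2)) = Fintype.card β := by
      rw [hY, card_sdiff_add_card_eq_card (subset_univ _), card_univ]
    have h3 : Fintype.card β ≤ 2 * #Y := by simp only at hR; omega
    have : (Fintype.card β : ℝ) ≤ 2 * #Y := by exact_mod_cast h3
    linarith
  have key : #({M : ι → β ≃ β | Realises (insert (e, x, y) R) M} : Finset _) * #Y ≤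
      #({M : ι → β ≃ β | Realises R M} : Finset _) := by
    rw [← card_product]
    refine card_le_card_of_injOn
      (fun q => Function.update q.1 e ((q.1 e).trans (Equiv.swap y q.2))) ?_ ?_
    · rintro ⟨M, y'⟩ hq
      simp only [coe_product, coe_filter, mem_univ, true_and, Set.mem_prod, Set.mem_ofPred_eq,
        mem_coe] at hq ⊢
      obtain ⟨hM, hy'⟩ := hq
      rintro ⟨e₁, x₁, y₁⟩ h₁
      have hM₁ := hM _ (mem_insert_of_mem h₁)
      have hM₀ := hM _ (mem_insert_self _ _)
      simp only at hM₁ hM₀ ⊢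
      by_cases he : e₁ = e
      · subst he
        have hne : y₁ ≠ y := by
          rintro rfl
          have : x₁ = x := (M e₁).injective (hM₁.trans hM₀.symm)
          subst this
          exact ht h₁
        have hne' : y₁ ≠ y' := by
          rintro rfl
          simp only [hY, mem_sdiff, mem_univ, true_and, mem_image, mem_filter, not_exists] at hy'
          exact hy' _ ⟨⟨h₁, rfl⟩, rfl⟩
        simp [hM₁, Equiv.swap_apply_of_ne_of_ne hne hne']
      · simp [Function.update_of_ne he, hM₁]
    · rintro ⟨M, y'⟩ hq ⟨M₁, y₁⟩ hq₁ heq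
      simp only [coe_product, coe_filter, mem_univ, true_and, Set.mem_prod, Set.mem_ofPred_eq,
        mem_coe] at hq hq₁ heq
      have hx : M e x = y := hq.1 _ (mem_insert_self _ _)
      have hx₁ : M₁ e x = y := hq₁.1 _ (mem_insert_self _ _)
      have hee := congrFun heq e
      simp only [Function.update_self] at hee
      have hyy : y' = y₁ := by
        have := congrArg (fun σ => σ x) hee
        simpa [hx, hx₁] using this
      subst hyy
      refine Prod.ext ?_ rfl
      funext e'
      by_cases he : e' = e
      · subst he
        ext z
        have := congrArg (fun σ => σ z) hee
        simpa using this
      · have := congrFun heq e'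
        simpa [Function.update_of_ne he] using this
  calc _ ≤ (#({M : ι → β ≃ β | Realises (insert (e, x, y) R) M} : Finset _) : ℝ) * #Y := by gcongr
    _ ≤ _ := by exact_mod_cast key

open Classical in
/-- If `R` has at most `|β| / 2` triples over each index, then a uniformly random family of
bijections realises `R` with probability at most `(2 / |β|) ^ |R|`. -/
theorem card_realises_mul_le {ι β : Type} [Fintype ι] [Fintype β] [DecidableEq ι] [DecidableEq β]
    (R : Finset (ι × β × β)) (hR : ∀ e, 2 * #{s ∈ R | s.1 = e} ≤ Fintype.card β) :
    (#{M : ι → β ≃ β | Realises R M} : ℝ) * ((Fintype.card β : ℝ) / 2) ^ #R ≤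
      Fintype.card (ι → β ≃ β) := by
  induction R using Finset.induction_on with
  | empty =>
    have h := card_le_univ ({M | Realises ∅ M} : Finset (ι → β ≃ β))
    rw [card_empty, pow_zero, mul_one]
    exact_mod_cast h
  | insert t R ht ih =>
    have hsub : ∀ e, #{s ∈ R | s.1 = e} ≤ #{s ∈ insert t R | s.1 = e} := fun e =>
      card_le_card (filter_subset_filter _ (subset_insert _ _))
    have hR' : ∀ e, 2 * #{s ∈ R | s.1 = e} ≤ Fintype.card β := fun e =>
      (Nat.mul_le_mul_left 2 (hsub e)).trans (hR e)
    rw [card_insert_of_notMem ht, pow_succ']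
    calc _ = (#{M : ι → β ≃ β | Realises (insert t R) M} : ℝ) * ((Fintype.card β : ℝ) / 2) *
          ((Fintype.card β : ℝ) / 2) ^ #R := by ring
      _ ≤ (#{M : ι → β ≃ β | Realises R M} : ℝ) * ((Fintype.card β : ℝ) / 2) ^ #R := by
          gcongr
          exact card_realises_insert R t ht (hR' _)
      _ ≤ _ := ih hR'

/-- A finite graph with at least one edge and no vertex of degree one contains a cycle. -/
theorem exists_isCycle_of_no_leaf {V : Type} [Fintype V] (F : SimpleGraph V) {a b : V}
    (hab : F.Adj a b) (hF : ∀ u w, F.Adj u w → ∃ w', w' ≠ w ∧ F.Adj u w') :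
    ∃ (v : V) (c : F.Walk v v), c.IsCycle := by
  by_contra hcon
  have hac : F.IsAcyclic := fun v c hc => hcon ⟨v, c, hc⟩
  have hpath : ∀ k : ℕ, ∃ (u v : V) (p : F.Walk u v), p.IsPath ∧ p.length = k + 1 := by
    intro k
    induction k with
    | zero =>
      exact ⟨a, b, hab.toWalk, by simp [hab.ne], rfl⟩
    | succ k ih =>
      obtain ⟨u, v, p, hp, hlen⟩ := ih
      have hnil : ¬ p.Nil := by
        intro h
        rw [← SimpleGraph.Walk.length_eq_zero_iff] at h
        omega
      obtain ⟨w, hw, hadj⟩ := hF u _ (p.adj_snd hnil)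
      have hws : w ∉ p.support := fun hmem => hw (hac.eq_snd_of_adj_start hp hadj hmem)
      exact ⟨w, v, SimpleGraph.Walk.cons hadj.symm p, hp.cons hws, by simp [hlen]⟩
  obtain ⟨u, v, p, hp, hlen⟩ := hpath (Fintype.card V)
  have := hp.length_lt
  omega

/-- The mod-`2` boundary of an edge with respect to vertex weights `δ`. -/
def edgeBoundary {X A : Type} [AddCommGroup A] (δ : X → A) : Sym2 X → A :=
  Sym2.lift ⟨fun u v => δ u + δ v, fun _ _ => add_comm _ _⟩

@[simp] theorem edgeBoundary_mk {X A : Type} [AddCommGroup A] (δ : X → A) (u v : X) :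
    edgeBoundary δ s(u, v) = δ u + δ v := rfl

theorem add_self_eq_zero_of_zmod_two {A : Type} [AddCommGroup A] [Module (ZMod 2) A] (a : A) :
    a + a = 0 := by
  rw [← two_smul (ZMod 2) a, show (2 : ZMod 2) = 0 from rfl, zero_smul]

theorem sum_edgeBoundary_walk {X A : Type} [AddCommGroup A] [Module (ZMod 2) A]
    {Gr : SimpleGraph X} (δ : X → A) {u v : X} (p : Gr.Walk u v) :
    (p.edges.map (edgeBoundary δ)).sum = δ u + δ v := by
  induction p with
  | nil => simp [add_self_eq_zero_of_zmod_two]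
  | @cons u v w hadj p ih =>
    simp only [SimpleGraph.Walk.edges_cons, List.map_cons, List.sum_cons, ih, edgeBoundary_mk]
    calc δ u + δ v + (δ v + δ w) = δ u + (δ v + δ v) + δ w := by abel
      _ = δ u + δ w := by rw [add_self_eq_zero_of_zmod_two, add_zero]

/-- The mod-`2` cycle space of a subgraph is generated by its simple cycles. -/
theorem cycle_space_induction {V : Type} [Fintype V] [DecidableEq V] {G : SimpleGraph V}
    (G' : G.Subgraph) (p : (Sym2 V → ZMod 2) → Prop) (h0 : p 0)
    (hadd : ∀ z z', p z → p z' → p (z + z'))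
    (hcyc : ∀ (v : V) (c : G.Walk v v), c.IsCycle → (∀ e ∈ c.edges, e ∈ G'.edgeSet) →
      p (fun e => if e ∈ c.edges then 1 else 0))
    (z : Sym2 V → ZMod 2) (hz : ∀ e, z e ≠ 0 → e ∈ G'.edgeSet)
    (hbd : ∑ e, z e • edgeBoundary (fun v => (Pi.single v 1 : V → ZMod 2)) e = 0) : p z := by
  obtain ⟨m, hm⟩ : ∃ m, m = #{e | z e ≠ 0} := ⟨_, rfl⟩
  induction m using Nat.strong_induction_on generalizing z with
  | _ m ih =>
  by_cases hzero : z = 0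
  · rwa [hzero]
  have zmod2 : ∀ a : ZMod 2, a ≠ 0 → a = 1 := by decide
  let F : SimpleGraph V := SimpleGraph.fromEdgeSet {e | z e ≠ 0}
  have hFadj : ∀ u w, F.Adj u w ↔ z s(u, w) ≠ 0 := by
    intro u w
    simp only [F, SimpleGraph.fromEdgeSet_adj, Set.mem_ofPred_eq, and_iff_left_iff_imp]
    intro h
    exact ((SimpleGraph.Subgraph.mem_edgeSet.mp (hz _ h)).adj_sub).ne
  obtain ⟨e₀, he₀⟩ := Function.ne_iff.mp hzero
  obtain ⟨a, b, hab⟩ : ∃ a b, F.Adj a b := by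
    induction e₀ using Sym2.ind with
    | _ a b => exact ⟨a, b, (hFadj a b).mpr he₀⟩
  obtain ⟨v, c, hc⟩ := exists_isCycle_of_no_leaf F hab (by
    intro u w huw
    by_contra hcon
    push Not at hcon
    have h1 := congrFun hbd u
    rw [Finset.sum_apply, Finset.sum_eq_single s(u, w)] at h1
    · simp only [edgeBoundary_mk, Pi.smul_apply, Pi.add_apply, Pi.single_eq_same, smul_eq_mul,
        Pi.single_eq_of_ne huw.ne, Pi.zero_apply, add_zero, mul_one] at h1
      exact (hFadj u w).mp huw h1
    · intro e _ hne
      by_cases hze : z e = 0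
      · simp [hze]
      induction e using Sym2.ind with
      | _ x y =>
        have hxy : F.Adj x y := (hFadj x y).mpr hze
        have hux : u ≠ x := by
          rintro rfl
          by_cases hyw : y = w
          · exact hne (by rw [hyw])
          · exact hcon y hyw hxy
        have huy : u ≠ y := by
          rintro rfl
          by_cases hyw : x = w
          · exact hne (by rw [hyw, Sym2.eq_swap])
          · exact hcon x hyw hxy.symm
        simp [Pi.single_eq_of_ne hux, Pi.single_eq_of_ne huy]
    · simp)
  have hFG : F ≤ G := fun x y hxy =>
    (SimpleGraph.Subgraph.mem_edgeSet.mp (hz _ ((hFadj x y).mp hxy))).adj_sub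
  have hcz : ∀ e ∈ c.edges, z e ≠ 0 := by
    intro e he
    have := c.edges_subset_edgeSet he
    induction e using Sym2.ind with
    | _ x y => exact (hFadj x y).mp this
  set ind : Sym2 V → ZMod 2 := fun e => if e ∈ c.edges then 1 else 0 with hind
  have hpc : p ind := by
    have := hcyc v (c.mapLe hFG) (hc.mapLe hFG) (by
      intro e he
      rw [SimpleGraph.Walk.edges_mapLe_eq_edges] at he
      exact hz e (hcz e he))
    simpa [SimpleGraph.Walk.edges_mapLe_eq_edges] using this
  have hindbd : ∑ e, ind e • edgeBoundary (fun v => (Pi.single v 1 : V → ZMod 2)) e = 0 := by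
    have h1 := sum_edgeBoundary_walk (fun v => (Pi.single v 1 : V → ZMod 2)) c
    rw [add_self_eq_zero_of_zmod_two, ← List.sum_toFinset _ hc.edges_nodup] at h1
    rw [← h1]
    simp only [hind, ite_smul, one_smul, zero_smul, ← Finset.sum_filter]
    refine Finset.sum_congr ?_ fun _ _ => rfl
    ext e
    simp
  have hrest : p (z + ind) := by
    refine ih _ ?_ (z + ind) ?_ ?_ rfl
    · rw [hm]
      refine Finset.card_lt_card ?_
      rw [Finset.ssubset_iff_of_subset]
      · obtain ⟨e, he⟩ : ∃ e, e ∈ c.edges := by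
          have : c.edges ≠ [] := by
            simpa using hc.ne_nil
          exact List.exists_mem_of_ne_nil _ this
        refine ⟨e, by simpa using hcz e he, ?_⟩
        simp only [Pi.add_apply, ne_eq, mem_filter, mem_univ, true_and, not_not, hind, if_pos he,
          zmod2 _ (hcz e he)]
        decide
      · intro e he
        simp only [Pi.add_apply, ne_eq, mem_filter, mem_univ, true_and, hind] at he ⊢
        intro h
        by_cases hce : e ∈ c.edges
        · exact hcz e hce h
        · simp [h, hce] at he
    · intro e he
      by_cases hce : e ∈ c.edges
      · exact hz e (hcz e hce)
      · simp only [Pi.add_apply, hind, if_neg hce, add_zero] at he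
        exact hz e he
    · simp only [Pi.add_apply, add_smul, Finset.sum_add_distrib, hbd, hindbd, add_zero]
  have : z = (z + ind) + ind := by
    rw [add_assoc, add_self_eq_zero_of_zmod_two, add_zero]
  rw [this]
  exact hadd _ _ hrest hpc

theorem sum_count_smul {X A : Type} [DecidableEq X] [AddCommGroup A] [Module (ZMod 2) A]
    (K : Finset X) (β : X → A) (l : List X) (hl : ∀ e ∈ l, e ∉ K → β e = 0) :
    ∑ k : K, (l.count k.1 : ZMod 2) • β k.1 = (l.map β).sum := by
  induction l with
  | nil => simp
  | cons e l ih =>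
    have ih' := ih fun x hx => hl x (List.mem_cons_of_mem _ hx)
    simp only [List.count_cons, Nat.cast_add, add_smul, Finset.sum_add_distrib, ih', List.map_cons,
      List.sum_cons]
    rw [add_comm]
    congr 1
    rw [Finset.sum_coe_sort K (fun k => ((if (e == k) = true then 1 else 0 : ℕ) : ZMod 2) • β k)]
    by_cases he : e ∈ K
    · rw [Finset.sum_eq_single e]
      · simp
      · intro b _ hb
        simp [hb.symm]
      · exact fun h => absurd he h
    · rw [hl e List.mem_cons_self he]
      refine Finset.sum_eq_zero fun k hk => ?_
      have : e ≠ k := fun h => he (h ▸ hk)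
      simp [this]

/-- The mod-`2` image in `G` of an edge of the extension graph. -/
def projIndicator [DecidableEq VG] (e : Sym2 (VG × VH)) : Sym2 VG → ZMod 2 :=
  if (e.map Prod.fst).IsDiag then 0 else Pi.single (e.map Prod.fst) 1

theorem sum_projIndicator_walk [DecidableEq VG] {X : SimpleGraph (VG × VH)} {a b : VG × VH}
    (p : X.Walk a b) :
    (p.edges.map projIndicator).sum = fun e => ((projEdges p).count e : ZMod 2) := by
  unfold projEdges
  generalize p.edges = l
  induction l with
  | nil => funext e; simp
  | cons x l ih =>
    rw [List.map_cons, List.sum_cons, ih]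
    funext e
    rw [← Multiset.cons_coe, Multiset.map_cons]
    by_cases hx : (x.map Prod.fst).IsDiag
    · rw [Multiset.filter_cons_of_neg (p := fun e : Sym2 VG => ¬ e.IsDiag) _ (not_not.mpr hx)]
      simp [projIndicator, hx]
    · rw [Multiset.filter_cons_of_pos (p := fun e : Sym2 VG => ¬ e.IsDiag) _ hx, Multiset.count_cons]
      simp only [projIndicator, hx, if_false, Pi.add_apply, Pi.single_apply, Nat.cast_add,
        Nat.cast_ite, Nat.cast_one, Nat.cast_zero]
      rw [add_comm]

section Euler

variable [Fintype VG] [Fintype VH] [DecidableEq VG] [DecidableEq VH] {G : SimpleGraph VG}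
  {X : SimpleGraph (VG × VH)} (G' : G.Subgraph) (f : VG → VG × VH)
  (P : ∀ {g₁ g₂ : VG}, G'.Adj g₁ g₂ → X.Walk (f g₁) (f g₂)) (K : Finset (Sym2 (VG × VH)))

/-- Pairs (mod-`2` chain on `K`, mod-`2` boundary in `G`) generated by the walks `P`. -/
def walkSpace : Submodule (ZMod 2) ((K → ZMod 2) × (VG → ZMod 2)) :=
  Submodule.span _ {w | ∃ (g₁ g₂ : VG) (h : G'.Adj g₁ g₂),
    w = (fun k => ((P h).edges.count k.1 : ZMod 2), Pi.single g₁ 1 + Pi.single g₂ 1)}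

/-- The projection of mod-`2` chains on `K` to mod-`2` chains of `G`. -/
def projChain : (K → ZMod 2) →ₗ[ZMod 2] (Sym2 VG → ZMod 2) :=
  Fintype.linearCombination (ZMod 2) (fun k : K => projIndicator k.1)

variable {G' f P K}

omit [Fintype VG] [Fintype VH] in
theorem exists_mem_walkSpace_of_walk
    (hK : ∀ g₁ g₂ (h : G'.Adj g₁ g₂), ∀ e ∈ (P h).edges, ¬ (e.map Prod.fst).IsDiag → e ∈ K)
    {u v : VG} (c : G.Walk u v) (hc : ∀ e ∈ c.edges, e ∈ G'.edgeSet) :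
    ∃ a, (a, (Pi.single u 1 + Pi.single v 1 : VG → ZMod 2)) ∈ walkSpace G' f P K ∧
      projChain K a = fun e =>
        ((combinedEdges (fun {_ _} hadj => projEdges (P hadj)) c hc).count e : ZMod 2) := by
  induction c with
  | nil =>
    refine ⟨0, ?_, ?_⟩
    · rw [add_self_eq_zero_of_zmod_two]
      exact Submodule.zero_mem _
    · rw [map_zero]
      funext e
      simp [combinedEdges]
  | @cons u v w hadj p ih =>
    obtain ⟨a, ha, hproj⟩ := ih (fun e he => hc e (by simp [he]))
    have h : G'.Adj u v := SimpleGraph.Subgraph.mem_edgeSet.mp (hc s(u, v) (by simp))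
    refine ⟨(fun k => ((P h).edges.count k.1 : ZMod 2)) + a, ?_, ?_⟩
    · have hgen : ((fun k => ((P h).edges.count k.1 : ZMod 2)),
          (Pi.single u 1 + Pi.single v 1 : VG → ZMod 2)) ∈ walkSpace G' f P K :=
        Submodule.subset_span ⟨u, v, h, rfl⟩
      have := Submodule.add_mem _ hgen ha
      rw [Prod.mk_add_mk] at this
      convert this using 2
      calc (Pi.single u 1 + Pi.single w 1 : VG → ZMod 2)
          = Pi.single u 1 + (Pi.single v 1 + Pi.single v 1) + Pi.single w 1 := by
            rw [add_self_eq_zero_of_zmod_two, add_zero]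
        _ = _ := by abel
    · rw [map_add, hproj]
      have h1 : projChain K (fun k => ((P h).edges.count k.1 : ZMod 2)) =
          fun e => ((projEdges (P h)).count e : ZMod 2) := by
        rw [← sum_projIndicator_walk, projChain, Fintype.linearCombination_apply]
        refine sum_count_smul K projIndicator (P h).edges ?_
        intro e he heK
        rw [projIndicator, if_pos]
        by_contra hd
        exact heK (hK _ _ h e he hd)
      rw [h1]
      funext e
      simp [combinedEdges]

open Classical in
theorem ncard_edgeSet_le_finrank_walkSpace
    (hom : IsCycleHomeo G' (fun {_ _} hadj => projEdges (P hadj)))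
    (hK : ∀ g₁ g₂ (h : G'.Adj g₁ g₂), ∀ e ∈ (P h).edges, ¬ (e.map Prod.fst).IsDiag → e ∈ K) :
    G'.edgeSet.ncard ≤ Module.finrank (ZMod 2) (walkSpace G' f P K) := by
  set E : Finset (Sym2 VG) := G'.edgeSet.toFinset with hE
  let bd : (E → ZMod 2) →ₗ[ZMod 2] (VG → ZMod 2) := Fintype.linearCombination (ZMod 2)
    (fun e : E => edgeBoundary (fun v => (Pi.single v 1 : VG → ZMod 2)) e.1)
  let pr : walkSpace G' f P K →ₗ[ZMod 2] (VG → ZMod 2) :=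
    (LinearMap.snd (ZMod 2) (K → ZMod 2) (VG → ZMod 2)).domRestrict (walkSpace G' f P K)
  let Q : walkSpace G' f P K →ₗ[ZMod 2] (E → ZMod 2) :=
    ((LinearMap.funLeft (ZMod 2) (ZMod 2) (Subtype.val : E → Sym2 VG)).comp
      ((projChain K).comp (LinearMap.fst (ZMod 2) (K → ZMod 2) (VG → ZMod 2)))).domRestrict
        (walkSpace G' f P K)
  have hrange : LinearMap.range bd ≤ LinearMap.range pr := by
    rw [Fintype.range_linearCombination, Submodule.span_le]
    rintro _ ⟨⟨e, he⟩, rfl⟩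
    induction e using Sym2.ind with
    | _ x y =>
      have h : G'.Adj x y := by simpa [hE] using he
      exact ⟨⟨_, Submodule.subset_span ⟨x, y, h, rfl⟩⟩, rfl⟩
  have hker : LinearMap.ker bd ≤ (LinearMap.ker pr).map Q := by
    intro z hz
    let z' : Sym2 VG → ZMod 2 := fun e => if h : e ∈ E then z ⟨e, h⟩ else 0
    have hz'E : ∀ e : E, z' e.1 = z e := fun e => by simp [z']
    have main : ∃ a, (a, (0 : VG → ZMod 2)) ∈ walkSpace G' f P K ∧ projChain K a = z' := by
      refine cycle_space_induction G'
        (fun z => ∃ a, (a, (0 : VG → ZMod 2)) ∈ walkSpace G' f P K ∧ projChain K a = z)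
        ⟨0, Submodule.zero_mem _, map_zero _⟩ ?_ ?_ z' ?_ ?_
      · rintro z₁ z₂ ⟨a, ha, rfl⟩ ⟨b, hb, rfl⟩
        refine ⟨a + b, ?_, map_add _ _ _⟩
        simpa using Submodule.add_mem _ ha hb
      · intro v c hc hmem
        obtain ⟨a, ha, hproj⟩ := exists_mem_walkSpace_of_walk hK c hmem
        rw [add_self_eq_zero_of_zmod_two] at ha
        refine ⟨a, ha, ?_⟩
        rw [hproj]
        funext e
        have hodd := Set.ext_iff.mp (hom v c hc hmem) e
        simp only [Set.mem_ofPred_eq] at hodd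
        by_cases hce : e ∈ c.edges
        · rw [if_pos hce, ZMod.natCast_eq_one_iff_odd]
          exact hodd.mpr hce
        · rw [if_neg hce, ZMod.natCast_eq_zero_iff_even, ← Nat.not_odd_iff_even]
          exact fun h => hce (hodd.mp h)
      · intro e he
        by_cases h : e ∈ E
        · simpa [hE] using h
        · simp [z', h] at he
      · rw [LinearMap.mem_ker, Fintype.linearCombination_apply] at hz
        rw [← hz, ← Finset.sum_subset (Finset.subset_univ E), ← Finset.sum_coe_sort E]
        · exact Finset.sum_congr rfl fun e _ => by rw [hz'E]
        · intro e _ he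
          simp [z', he]
    obtain ⟨a, ha, hproj⟩ := main
    refine ⟨⟨(a, 0), ha⟩, rfl, ?_⟩
    funext e
    change projChain K a e.1 = z e
    rw [hproj, hz'E]
  have h1 := LinearMap.finrank_range_add_finrank_ker bd
  have h2 := LinearMap.finrank_range_add_finrank_ker pr
  have h3 := Submodule.finrank_mono hrange
  have h4 := Submodule.finrank_mono hker
  have h5 := Submodule.finrank_map_le Q (LinearMap.ker pr)
  rw [Module.finrank_fintype_fun_eq_card, Fintype.card_coe] at h1
  have h6 : G'.edgeSet.ncard = #E := by rw [hE, Set.ncard_eq_toFinset_card']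
  omega

/-- If the walks `P` induce a cycle-homeomorphism, then the graph obtained from the union of
the walks by identifying vertices along `comp` has at least `|E(G')| - |V_G|` more edges than
vertices. -/
theorem ncard_edgeSet_add_card_le
    (hom : IsCycleHomeo G' (fun {_ _} hadj => projEdges (P hadj)))
    (hK : ∀ g₁ g₂ (h : G'.Adj g₁ g₂), ∀ e ∈ (P h).edges, ¬ (e.map Prod.fst).IsDiag → e ∈ K)
    {C : Type} [DecidableEq C] (comp : VG × VH → C)
    (hcomp : ∀ g₁ g₂ (h : G'.Adj g₁ g₂), ∀ u v, s(u, v) ∈ (P h).edges → u.1 = v.1 →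
      comp u = comp v)
    (Cl : Finset C)
    (hCl : ∀ c ∈ Cl, ∃ v, comp v = c ∧
      ((∃ g, v = f g) ∨ ∃ (g₁ g₂ : VG) (h : G'.Adj g₁ g₂), v ∈ (P h).support)) :
    G'.edgeSet.ncard + #Cl ≤ #K + Fintype.card VG := by
  let δ : VG × VH → (Cl → ZMod 2) := fun v c => if c.1 = comp v then 1 else 0
  let T : ((K → ZMod 2) × (VG → ZMod 2)) →ₗ[ZMod 2] (Cl → ZMod 2) :=
    (Fintype.linearCombination (ZMod 2) (fun k : K => edgeBoundary δ k.1)).coprod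
      (Fintype.linearCombination (ZMod 2) (fun g => δ (f g)))
  have hintra : ∀ g₁ g₂ (h : G'.Adj g₁ g₂), ∀ e ∈ (P h).edges, e ∉ K → edgeBoundary δ e = 0 := by
    intro g₁ g₂ h e he heK
    have hd : (e.map Prod.fst).IsDiag := by
      by_contra hd
      exact heK (hK _ _ h e he hd)
    induction e using Sym2.ind with
    | _ u v =>
      have : comp u = comp v := hcomp _ _ h u v he (by simpa using hd)
      rw [edgeBoundary_mk, show δ u = δ v by simp [δ, this], add_self_eq_zero_of_zmod_two]
  have hT_single : ∀ g, T (0, Pi.single g 1) = δ (f g) := by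
    intro g
    simp [T, Fintype.linearCombination_apply_single]
  have hS : walkSpace G' f P K ≤ LinearMap.ker T := by
    rw [walkSpace, Submodule.span_le]
    rintro _ ⟨g₁, g₂, h, rfl⟩
    have h1 : Fintype.linearCombination (ZMod 2) (fun k : K => edgeBoundary δ k.1)
        (fun k => ((P h).edges.count k.1 : ZMod 2)) = δ (f g₁) + δ (f g₂) := by
      rw [← sum_edgeBoundary_walk δ (P h), Fintype.linearCombination_apply]
      exact sum_count_smul K (edgeBoundary δ) (P h).edges (hintra _ _ h)
    rw [SetLike.mem_coe, LinearMap.mem_ker, LinearMap.coprod_apply, h1, map_add,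
      Fintype.linearCombination_apply_single, Fintype.linearCombination_apply_single, one_smul,
      one_smul, add_self_eq_zero_of_zmod_two]
  have hδf : ∀ g, δ (f g) ∈ LinearMap.range T := fun g => ⟨_, hT_single g⟩
  have hδP : ∀ (g₁ g₂ : VG) (h : G'.Adj g₁ g₂), ∀ v ∈ (P h).support,
      δ v ∈ LinearMap.range T := by
    intro g₁ g₂ h v hv
    have h1 := sum_edgeBoundary_walk δ ((P h).takeUntil v hv)
    have h2 : ((((P h).takeUntil v hv).edges).map (edgeBoundary δ)).sum ∈ LinearMap.range T := by
      refine list_sum_mem ?_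
      intro x hx
      obtain ⟨e, he, rfl⟩ := List.mem_map.mp hx
      have he' := (P h).edges_takeUntil_subset_edges hv he
      by_cases heK : e ∈ K
      · refine ⟨(Pi.single ⟨e, heK⟩ 1, 0), ?_⟩
        rw [LinearMap.coprod_apply, map_zero, add_zero, Fintype.linearCombination_apply_single,
          one_smul]
      · rw [hintra _ _ h e he' heK]
        exact Submodule.zero_mem _
    have h3 := Submodule.sub_mem _ h2 (hδf g₁)
    rwa [h1, add_sub_cancel_left] at h3
  have hrange : LinearMap.range T = ⊤ := by
    rw [eq_top_iff, ← (Pi.basisFun (ZMod 2) Cl).span_eq, Submodule.span_le]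
    rintro _ ⟨c, rfl⟩
    obtain ⟨v, hvc, hv⟩ := hCl c.1 c.2
    have hδ : Pi.basisFun (ZMod 2) Cl c = δ v := by
      funext c'
      rw [Pi.basisFun_apply, Pi.single_apply]
      simp only [δ, hvc, Subtype.ext_iff]
    rw [hδ]
    rcases hv with ⟨g, rfl⟩ | ⟨g₁, g₂, h, hv⟩
    · exact hδf g
    · exact hδP g₁ g₂ h v hv
  have h1 := LinearMap.finrank_range_add_finrank_ker T
  have h2 := Submodule.finrank_mono hS
  have h3 := ncard_edgeSet_le_finrank_walkSpace hom hK
  rw [hrange, finrank_top, Module.finrank_fintype_fun_eq_card, Fintype.card_coe,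
    Module.finrank_prod, Module.finrank_fintype_fun_eq_card, Module.finrank_fintype_fun_eq_card,
    Fintype.card_coe] at h1
  omega

end Euler

section Exploration

variable [DecidableEq VG] [DecidableEq VH]

/-- The constraint on the bijections `M` expressing that `u` and `v` are joined by an
inter-cloud edge. -/
def interRecord (EG : Finset (VG × VG)) (u v : VG × VH) : (VG × VG) × VH × VH :=
  if (u.1, v.1) ∈ EG then ((u.1, v.1), u.2, v.2) else ((v.1, u.1), v.2, u.2)

/-- The edge of the extension graph described by a constraint on the bijections. -/
def recordEdge (t : (VG × VG) × VH × VH) : Sym2 (VG × VH) := s((t.1.1, t.2.1), (t.1.2, t.2.2))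

omit [DecidableEq VH] in
theorem recordEdge_interRecord (EG : Finset (VG × VG)) (u v : VG × VH) :
    recordEdge (interRecord EG u v) = s(u, v) := by
  unfold interRecord recordEdge
  split_ifs
  · rfl
  · exact Sym2.eq_swap

variable [Group VG] [Group VH]

/-- The commands of the exploration: add an intra-cloud neighbour, add an inter-cloud
neighbour, close an inter-cloud edge between known vertices, add a root, or a control command
(advance one of the three pointers, or do nothing). -/
abbrev ExploreCmd (SG : Finset VG) (SH : Finset VH) (B : ℕ) : Type :=
  SH ⊕ (SG × VH) ⊕ (SG × Fin B) ⊕ VH ⊕ Fin 4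

/-- The state of the exploration: the list of discovered vertices, three pointers (for the
intra-cloud, inter-cloud and root scans), the recorded constraints, and the numbers of
inter-cloud discoveries, of closed inter-cloud edges and of roots. -/
structure ExploreState (VG VH : Type) where
  verts : List (VG × VH)
  intraPtr : ℕ
  interPtr : ℕ
  rootPtr : ℕ
  records : List ((VG × VG) × VH × VH)
  found : ℕ
  closed : ℕ
  roots : ℕ

variable {SG : Finset VG} {SH : Finset VH} {B : ℕ} (EG : Finset (VG × VG)) (us : List VG)

/-- Execution of a single command. -/
def exploreStep (st : ExploreState VG VH) : ExploreCmd SG SH B → ExploreState VG VH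
  | .inl s =>
    { st with
      verts := st.verts ++
        [((st.verts.getD st.intraPtr 1).1, (st.verts.getD st.intraPtr 1).2 * s)] }
  | .inr (.inl (s, y)) =>
    { st with
      verts := st.verts ++ [((st.verts.getD st.interPtr 1).1 * s, y)]
      records := interRecord EG (st.verts.getD st.interPtr 1)
        ((st.verts.getD st.interPtr 1).1 * s, y) :: st.records
      found := st.found + 1 }
  | .inr (.inr (.inl (s, t))) =>
    { st with
      records := interRecord EG (st.verts.getD st.interPtr 1)
        ((st.verts.filter (fun v => v.1 = (st.verts.getD st.interPtr 1).1 * s)).getD t 1) ::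
          st.records
      closed := st.closed + 1 }
  | .inr (.inr (.inr (.inl x))) =>
    { st with
      verts := st.verts ++ [(us.getD st.rootPtr 1, x)]
      roots := st.roots + 1 }
  | .inr (.inr (.inr (.inr 0))) => { st with intraPtr := st.intraPtr + 1 }
  | .inr (.inr (.inr (.inr 1))) => { st with interPtr := st.interPtr + 1 }
  | .inr (.inr (.inr (.inr 2))) => { st with rootPtr := st.rootPtr + 1 }
  | .inr (.inr (.inr (.inr _))) => st

/-- Execution of a list of commands. -/
def explore (st : ExploreState VG VH) (code : List (ExploreCmd SG SH B)) : ExploreState VG VH :=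
  code.foldl (exploreStep EG us) st

/-- The initial state. -/
def ExploreState.start : ExploreState VG VH := ⟨[], 0, 0, 0, [], 0, 0, 0⟩

/-- The progress made in a state. -/
def ExploreState.progress (st : ExploreState VG VH) : ℕ :=
  st.verts.length + st.intraPtr + st.interPtr + st.rootPtr + st.records.length

variable (W Rt : Finset (VG × VH)) (Y : SimpleGraph (VG × VH))
  (K : Finset ((VG × VG) × VH × VH)) {C : Type} [DecidableEq C] (comp : VG × VH → C)

/-- The invariant of an exploration of the graph `Y` on the vertex set `W` with roots `Rt`. -/
structure ExploreInv (st : ExploreState VG VH) : Prop where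
  nodup : st.verts.Nodup
  subset : ∀ v ∈ st.verts, v ∈ W
  intraPtr_le : st.intraPtr ≤ st.verts.length
  interPtr_le : st.interPtr ≤ st.verts.length
  rootPtr_le : st.rootPtr ≤ us.length
  intra_closed : ∀ u ∈ st.verts.take st.intraPtr, ∀ v, Y.Adj u v → u.1 = v.1 → v ∈ st.verts
  inter_closed : ∀ u ∈ st.verts.take st.interPtr, ∀ v, Y.Adj u v → u.1 ≠ v.1 →
    v ∈ st.verts ∧ interRecord EG u v ∈ st.records
  root_closed : ∀ g ∈ us.take st.rootPtr, ∀ v ∈ Rt, v.1 = g → v ∈ st.verts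
  records_nodup : st.records.Nodup
  records_spec : ∀ t ∈ st.records, ∃ u ∈ st.verts, ∃ v ∈ st.verts, Y.Adj u v ∧ u.1 ≠ v.1 ∧
    t = interRecord EG u v
  card_comp : #((st.verts.map comp).toFinset) = st.found + st.roots
  roots_le : st.roots ≤ (st.verts.filter (· ∈ Rt)).length

variable {EG us W Rt Y K comp}

theorem ExploreInv.start : ExploreInv EG us W Rt Y comp ExploreState.start := by
  constructor <;> simp [ExploreState.start]

omit [Group VG] [Group VH] in
theorem ExploreInv.progress_le {st : ExploreState VG VH} (inv : ExploreInv EG us W Rt Y comp st)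
    (hK : ∀ u v, Y.Adj u v → u.1 ≠ v.1 → interRecord EG u v ∈ K) :
    st.progress ≤ 3 * #W + us.length + #K := by
  have h1 : st.verts.length ≤ #W := by
    rw [← List.toFinset_card_of_nodup inv.nodup]
    exact card_le_card fun v hv => inv.subset v (List.mem_toFinset.mp hv)
  have h2 : st.records.length ≤ #K := by
    rw [← List.toFinset_card_of_nodup inv.records_nodup]
    refine card_le_card fun t ht => ?_
    obtain ⟨u, -, v, -, h, hne, rfl⟩ := inv.records_spec t (List.mem_toFinset.mp ht)
    exact hK u v h hne
  have h3 := inv.intraPtr_le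
  have h4 := inv.interPtr_le
  have h5 := inv.rootPtr_le
  unfold ExploreState.progress
  omega

theorem take_succ_eq_append_getD {α : Type} (l : List α) (i : ℕ) (x : α) (hi : i < l.length) :
    l.take (i + 1) = l.take i ++ [l.getD i x] := by
  rw [List.take_add_one, List.getElem?_eq_getElem hi, List.getD_eq_getElem _ _ hi]
  rfl

theorem getD_mem {α : Type} (l : List α) (i : ℕ) (x : α) (hi : i < l.length) :
    l.getD i x ∈ l := by
  rw [List.getD_eq_getElem _ _ hi]
  exact List.getElem_mem hi

variable (hcompY : ∀ u v, Y.Adj u v → u.1 = v.1 → comp u = comp v)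
  (hcompS : ∀ S : Set (VG × VH), (∀ u ∈ S, ∀ v, Y.Adj u v → u.1 = v.1 → v ∈ S) →
    ∀ u v, comp u = comp v → u ∈ S → v ∈ S)
  (hYW : ∀ u v, Y.Adj u v → v ∈ W) (hRtW : Rt ⊆ W)
  (hYintra : ∀ u v, Y.Adj u v → u.1 = v.1 → u.2⁻¹ * v.2 ∈ SH)
  (hYinter : ∀ u v, Y.Adj u v → u.1 ≠ v.1 → u.1⁻¹ * v.1 ∈ SG)
  (hB : ∀ g, #{v ∈ W | v.1 = g} ≤ B)

omit [Group VG] [Group VH] in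
theorem ExploreInv.append {st : ExploreState VG VH} (inv : ExploreInv EG us W Rt Y comp st)
    {v : VG × VH} (hvW : v ∈ W) (hv : v ∉ st.verts) {R : List ((VG × VG) × VH × VH)}
    (hR : st.records ⊆ R) (hRn : R.Nodup)
    (hRs : ∀ t ∈ R, t ∈ st.records ∨ ∃ u ∈ st.verts, Y.Adj u v ∧ u.1 ≠ v.1 ∧
      t = interRecord EG u v) {f k r : ℕ}
    (hcard : #((insert (comp v) (st.verts.map comp).toFinset)) = f + r)
    (hr : r ≤ st.roots ∨ (v ∈ Rt ∧ r ≤ st.roots + 1)) :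
    ExploreInv EG us W Rt Y comp
      ⟨st.verts ++ [v], st.intraPtr, st.interPtr, st.rootPtr, R, f, k, r⟩ := by
  obtain ⟨h1, h2, h3, h4, h5, h6, h7, h8, h9, h10, h11, h12⟩ := inv
  refine ⟨?_, ?_, ?_, ?_, h5, ?_, ?_, ?_, hRn, ?_, ?_, ?_⟩
  · simp only [List.nodup_append, h1, List.nodup_singleton, true_and]
    intro a ha b hb e
    rw [List.mem_singleton.mp hb] at e
    exact hv (e ▸ ha)
  · intro w hw
    rcases List.mem_append.mp hw with hw | hw
    · exact h2 w hw
    · rwa [List.mem_singleton.mp hw]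
  · simp; omega
  · simp; omega
  · simp only [List.take_append_of_le_length h3]
    exact fun x hx y hxy e => List.mem_append_left _ (h6 x hx y hxy e)
  · simp only [List.take_append_of_le_length h4]
    exact fun x hx y hxy e =>
      ⟨List.mem_append_left _ (h7 x hx y hxy e).1, hR (h7 x hx y hxy e).2⟩
  · exact fun g hg y hy e => List.mem_append_left _ (h8 g hg y hy e)
  · intro t ht
    rcases hRs t ht with h | ⟨u, hu, h⟩
    · obtain ⟨x, hx, y, hy, h⟩ := h10 t h
      exact ⟨x, List.mem_append_left _ hx, y, List.mem_append_left _ hy, h⟩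
    · exact ⟨u, List.mem_append_left _ hu, v, by simp, h⟩
  · rw [← hcard]
    congr 1
    ext c
    simp
  · simp only [List.filter_append, List.length_append]
    rcases hr with h | ⟨hvR, h⟩
    · omega
    · simp [hvR]; omega

include hcompY hYW hYintra in
theorem ExploreInv.exists_step_intra {st : ExploreState VG VH}
    (inv : ExploreInv EG us W Rt Y comp st) (ha : st.intraPtr < st.verts.length) :
    ∃ cmd : ExploreCmd SG SH B, ExploreInv EG us W Rt Y comp (exploreStep EG us st cmd) ∧
      st.progress < (exploreStep EG us st cmd).progress := by
  set u := st.verts.getD st.intraPtr 1 with hu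
  have hul : u ∈ st.verts := getD_mem _ _ _ ha
  by_cases h : ∃ v, Y.Adj u v ∧ u.1 = v.1 ∧ v ∉ st.verts
  · obtain ⟨v, hadj, huv, hv⟩ := h
    have hv' : (u.1, u.2 * (u.2⁻¹ * v.2)) = v := by
      ext <;> simp [huv]
    refine ⟨.inl ⟨u.2⁻¹ * v.2, hYintra u v hadj huv⟩, ?_, ?_⟩
    · simp only [exploreStep, ← hu, hv']
      refine inv.append (hYW u v hadj) hv (List.Subset.refl _) inv.records_nodup
        (fun t ht => .inl ht) ?_ (.inl le_rfl)
      rw [← inv.card_comp, insert_eq_of_mem]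
      exact List.mem_toFinset.mpr (List.mem_map.mpr ⟨u, hul, hcompY u v hadj huv⟩)
    · simp [exploreStep, ExploreState.progress]
  · push Not at h
    refine ⟨.inr (.inr (.inr (.inr 0))), ?_, ?_⟩
    · obtain ⟨h1, h2, h3, h4, h5, h6, h7, h8, h9, h10, h11, h12⟩ := inv
      refine ⟨h1, h2, ha, h4, h5, ?_, h7, h8, h9, h10, h11, h12⟩
      simp only [exploreStep]
      rw [take_succ_eq_append_getD _ _ 1 ha, ← hu]
      intro x hx y hxy e
      rcases List.mem_append.mp hx with hx | hx
      · exact h6 x hx y hxy e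
      · rw [List.mem_singleton.mp hx] at hxy e
        exact h y hxy e
    · simp [exploreStep, ExploreState.progress]

include hcompS in
omit [Group VG] [Group VH] in
theorem comp_notMem_of_closed {st : ExploreState VG VH}
    (inv : ExploreInv EG us W Rt Y comp st)
    (ha : st.intraPtr = st.verts.length) {v : VG × VH} (hv : v ∉ st.verts) :
    comp v ∉ (st.verts.map comp).toFinset := by
  intro h
  obtain ⟨u, hu, huv⟩ := List.mem_map.mp (List.mem_toFinset.mp h)
  refine hv (hcompS {w | w ∈ st.verts} ?_ u v huv hu)
  intro x hx y hxy e
  have := inv.intra_closed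
  rw [ha, List.take_length] at this
  exact this x hx y hxy e

include hcompS hYW hYinter hB in
theorem ExploreInv.exists_step_inter {st : ExploreState VG VH}
    (inv : ExploreInv EG us W Rt Y comp st) (ha : st.intraPtr = st.verts.length)
    (hb : st.interPtr < st.verts.length) :
    ∃ cmd : ExploreCmd SG SH B, ExploreInv EG us W Rt Y comp (exploreStep EG us st cmd) ∧
      st.progress < (exploreStep EG us st cmd).progress := by
  set u := st.verts.getD st.interPtr 1 with hu
  have hul : u ∈ st.verts := getD_mem _ _ _ hb
  by_cases h : ∃ v, Y.Adj u v ∧ u.1 ≠ v.1 ∧ interRecord EG u v ∉ st.records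
  · obtain ⟨v, hadj, huv, hR⟩ := h
    have hs := hYinter u v hadj huv
    have hv1 : u.1 * (u.1⁻¹ * v.1) = v.1 := mul_inv_cancel_left _ _
    by_cases hv : v ∈ st.verts
    · have hvf : v ∈ st.verts.filter (fun w => w.1 = v.1) := by simp [hv]
      obtain ⟨t, ht, hvt⟩ := List.getElem_of_mem hvf
      have htB : t < B := by
        refine ht.trans_le (le_trans ?_ (hB v.1))
        rw [← List.toFinset_card_of_nodup (inv.nodup.filter _)]
        refine card_le_card fun w hw => ?_
        rw [List.mem_toFinset, List.mem_filter] at hw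
        exact mem_filter.mpr ⟨inv.subset w hw.1, by simpa using hw.2⟩
      refine ⟨.inr (.inr (.inl (⟨_, hs⟩, ⟨t, htB⟩))), ?_, ?_⟩
      · simp only [exploreStep, ← hu, hv1, List.getD_eq_getElem _ _ ht, hvt]
        obtain ⟨h1, h2, h3, h4, h5, h6, h7, h8, h9, h10, h11, h12⟩ := inv
        refine ⟨h1, h2, h3, h4, h5, h6, ?_, h8, List.nodup_cons.mpr ⟨hR, h9⟩, ?_, h11, h12⟩
        · exact fun x hx y hxy e =>
            ⟨(h7 x hx y hxy e).1, List.mem_cons_of_mem _ (h7 x hx y hxy e).2⟩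
        · intro t ht
          rcases List.mem_cons.mp ht with rfl | ht
          · exact ⟨u, hul, v, hv, hadj, huv, rfl⟩
          · exact h10 t ht
      · simp [exploreStep, ExploreState.progress]
    · refine ⟨.inr (.inl (⟨_, hs⟩, v.2)), ?_, ?_⟩
      · simp only [exploreStep, ← hu, hv1]
        refine inv.append (hYW u v hadj) hv (List.subset_cons_self _ _)
          (List.nodup_cons.mpr ⟨hR, inv.records_nodup⟩) ?_ ?_ (.inl le_rfl)
        · intro t ht
          rcases List.mem_cons.mp ht with rfl | ht
          · exact .inr ⟨u, hul, hadj, huv, rfl⟩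
          · exact .inl ht
        · rw [card_insert_of_notMem (comp_notMem_of_closed hcompS inv ha hv), inv.card_comp]
          omega
      · simp [exploreStep, ExploreState.progress]
        omega
  · push Not at h
    refine ⟨.inr (.inr (.inr (.inr 1))), ?_, ?_⟩
    · obtain ⟨h1, h2, h3, h4, h5, h6, h7, h8, h9, h10, h11, h12⟩ := inv
      refine ⟨h1, h2, h3, hb, h5, h6, ?_, h8, h9, h10, h11, h12⟩
      simp only [exploreStep]
      rw [take_succ_eq_append_getD _ _ 1 hb, ← hu]
      intro x hx y hxy e
      rcases List.mem_append.mp hx with hx | hx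
      · exact h7 x hx y hxy e
      · rw [List.mem_singleton.mp hx] at hxy e ⊢
        refine ⟨?_, h y hxy e⟩
        obtain ⟨p, hp, q, hq, -, -, heq⟩ := h10 _ (h y hxy e)
        have := congrArg recordEdge heq
        rw [recordEdge_interRecord, recordEdge_interRecord, Sym2.eq_iff] at this
        rcases this with ⟨-, rfl⟩ | ⟨-, rfl⟩
        · exact hq
        · exact hp
    · simp [exploreStep, ExploreState.progress]

include hcompS hRtW in
theorem ExploreInv.exists_step_root {st : ExploreState VG VH}
    (inv : ExploreInv EG us W Rt Y comp st) (ha : st.intraPtr = st.verts.length)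
    (hc : st.rootPtr < us.length) :
    ∃ cmd : ExploreCmd SG SH B, ExploreInv EG us W Rt Y comp (exploreStep EG us st cmd) ∧
      st.progress < (exploreStep EG us st cmd).progress := by
  set g := us.getD st.rootPtr 1 with hg
  by_cases h : ∃ v ∈ Rt, v.1 = g ∧ v ∉ st.verts
  · obtain ⟨v, hvR, hvg, hv⟩ := h
    refine ⟨.inr (.inr (.inr (.inl v.2))), ?_, ?_⟩
    · simp only [exploreStep, ← hg, ← hvg]
      refine inv.append (hRtW hvR) hv (List.Subset.refl _) inv.records_nodup
        (fun t ht => .inl ht) ?_ (.inr ⟨hvR, le_rfl⟩)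
      rw [card_insert_of_notMem (comp_notMem_of_closed hcompS inv ha hv), inv.card_comp]
      omega
    · simp [exploreStep, ExploreState.progress]
  · push Not at h
    refine ⟨.inr (.inr (.inr (.inr 2))), ?_, ?_⟩
    · obtain ⟨h1, h2, h3, h4, h5, h6, h7, h8, h9, h10, h11, h12⟩ := inv
      refine ⟨h1, h2, h3, h4, hc, h6, h7, ?_, h9, h10, h11, h12⟩
      simp only [exploreStep]
      rw [take_succ_eq_append_getD _ _ 1 hc, ← hg]
      intro x hx y hy e
      rcases List.mem_append.mp hx with hx | hx
      · exact h8 x hx y hy e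
      · rw [List.mem_singleton.mp hx] at e
        exact h y hy e
    · simp [exploreStep, ExploreState.progress]

include hcompY hcompS hYW hRtW hYintra hYinter hB in
/-- From every state satisfying the invariant, the exploration can be completed. -/
theorem ExploreInv.exists_code (hK : ∀ u v, Y.Adj u v → u.1 ≠ v.1 → interRecord EG u v ∈ K)
    {st : ExploreState VG VH} (inv : ExploreInv EG us W Rt Y comp st) :
    ∃ code : List (ExploreCmd SG SH B),
      code.length + st.progress ≤ 3 * #W + us.length + #K ∧
      ExploreInv EG us W Rt Y comp (explore EG us st code) ∧
      (explore EG us st code).intraPtr = (explore EG us st code).verts.length ∧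
      (explore EG us st code).interPtr = (explore EG us st code).verts.length ∧
      (explore EG us st code).rootPtr = us.length := by
  induction h : 3 * #W + us.length + #K - st.progress using Nat.strong_induction_on
    generalizing st with
  | _ m ih =>
    have hle := inv.progress_le hK
    have step : (∃ cmd : ExploreCmd SG SH B,
        ExploreInv EG us W Rt Y comp (exploreStep EG us st cmd) ∧
          st.progress < (exploreStep EG us st cmd).progress) →
        ∃ code : List (ExploreCmd SG SH B),
          code.length + st.progress ≤ 3 * #W + us.length + #K ∧
          ExploreInv EG us W Rt Y comp (explore EG us st code) ∧
          (explore EG us st code).intraPtr = (explore EG us st code).verts.length ∧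
          (explore EG us st code).interPtr = (explore EG us st code).verts.length ∧
          (explore EG us st code).rootPtr = us.length := by
      rintro ⟨cmd, inv', hlt⟩
      have hle' := inv'.progress_le hK
      obtain ⟨code, hcode, hrest⟩ := ih _ (by omega) inv' rfl
      refine ⟨cmd :: code, ?_, hrest⟩
      rw [List.length_cons]
      omega
    rcases inv.intraPtr_le.lt_or_eq with ha | ha
    · exact step (inv.exists_step_intra hcompY hYW hYintra ha)
    rcases inv.interPtr_le.lt_or_eq with hb | hb
    · exact step (inv.exists_step_inter hcompS hYW hYinter hB ha hb)
    rcases inv.rootPtr_le.lt_or_eq with hc | hc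
    · exact step (inv.exists_step_root hcompS hRtW ha hc)
    exact ⟨[], by simpa using hle, inv, ha, hb, hc⟩

end Exploration

section Counting

variable [DecidableEq VG] [DecidableEq VH] [Group VG] [Group VH] {SG : Finset VG}
  {SH : Finset VH} {B : ℕ}

/-- The weight of a command: the reciprocal, up to a factor `2`, of the number of values of
its unbounded argument. -/
def cmdWeight (n : ℝ) : ExploreCmd SG SH B → ℝ
  | .inl _ => 1
  | .inr (.inl _) => 2 / n
  | .inr (.inr (.inl _)) => 2 / B
  | .inr (.inr (.inr (.inl _))) => 1 / n
  | .inr (.inr (.inr (.inr _))) => 1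

omit [DecidableEq VG] [DecidableEq VH] [Group VG] [Group VH] in
theorem cmdWeight_nonneg {n : ℝ} (hn : 0 < n) (c : ExploreCmd SG SH B) : 0 ≤ cmdWeight n c := by
  rcases c with _ | _ | _ | _ | _ <;> simp only [cmdWeight] <;> positivity

omit [DecidableEq VG] [DecidableEq VH] [Group VG] [Group VH] in
theorem sum_cmdWeight [Fintype VH] {d : ℕ} (hSG : #SG = d) (hSH : #SH = d) (hB : 0 < B)
    (hn : 0 < Fintype.card VH) :
    ∑ c : ExploreCmd SG SH B, cmdWeight (Fintype.card VH) c = 5 * d + 5 := by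
  have h1 : (Fintype.card VH : ℝ) ≠ 0 := by positivity
  have h2 : (B : ℝ) ≠ 0 := by positivity
  simp only [Fintype.sum_sum_type, cmdWeight, sum_const, card_univ, Fintype.card_prod,
    Fintype.card_coe, Fintype.card_fin, hSG, hSH, nsmul_eq_mul, Nat.cast_mul]
  field_simp
  push_cast
  ring

variable (EG : Finset (VG × VG)) (us : List VG)

omit [DecidableEq VH] in
theorem explore_append_singleton (st : ExploreState VG VH) (code : List (ExploreCmd SG SH B))
    (c : ExploreCmd SG SH B) :
    explore EG us st (code ++ [c]) = exploreStep EG us (explore EG us st code) c := by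
  simp [explore]

omit [DecidableEq VH] in
theorem explore_replicate_nop (st : ExploreState VG VH) (m : ℕ) :
    explore (SG := SG) (SH := SH) (B := B) EG us st
      (List.replicate m (.inr (.inr (.inr (.inr 3))))) = st := by
  induction m with
  | zero => rfl
  | succ m ih => exact ih

omit [DecidableEq VH] in
theorem length_records_explore (code : List (ExploreCmd SG SH B)) :
    (explore EG us .start code).records.length =
      (explore EG us .start code).found + (explore EG us .start code).closed := by
  induction code using List.reverseRecOn with
  | nil => rfl
  | append_singleton code c ih =>
    rw [explore_append_singleton]
    rcases c with _ | _ | _ | _ | i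
    · exact ih
    · simp only [exploreStep, List.length_cons]; omega
    · simp only [exploreStep, List.length_cons]; omega
    · exact ih
    · fin_cases i <;> exact ih

omit [DecidableEq VH] in
theorem prod_cmdWeight_mul (code : List (ExploreCmd SG SH B)) {n : ℝ} (hn : n ≠ 0) (hB : B ≠ 0) :
    (code.map (cmdWeight n)).prod *
      (n ^ ((explore EG us .start code).found + (explore EG us .start code).roots) *
        (B : ℝ) ^ (explore EG us .start code).closed) =
      2 ^ ((explore EG us .start code).found + (explore EG us .start code).closed) := by
  have hB' : (B : ℝ) ≠ 0 := by exact_mod_cast hB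
  induction code using List.reverseRecOn with
  | nil => simp [explore, ExploreState.start]
  | append_singleton code c ih =>
    rw [explore_append_singleton, List.map_append, List.prod_append]
    generalize explore EG us .start code = st at *
    rcases c with c | c | c | c | i
    · simpa [cmdWeight, exploreStep] using ih
    · simp only [exploreStep, List.map_cons, List.map_nil, List.prod_singleton, cmdWeight,
        show st.found + 1 + st.roots = st.found + st.roots + 1 by omega,
        show st.found + 1 + st.closed = st.found + st.closed + 1 by omega, pow_succ _ (_ + _)]
      rw [← ih]
      field_simp
    · simp only [exploreStep, List.map_cons, List.map_nil, List.prod_singleton, cmdWeight,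
        ← add_assoc, pow_succ]
      rw [← ih]
      field_simp
    · simp only [exploreStep, List.map_cons, List.map_nil, List.prod_singleton, cmdWeight,
        ← add_assoc, pow_succ]
      rw [← ih]
      field_simp
    · fin_cases i <;> simpa [cmdWeight, exploreStep] using ih

open Classical in
/-- A counting argument: some family of bijections realises no constraint set produced by a
code of length `Λ` with many more closed edges than roots. -/
theorem exists_not_realises [Fintype VG] [Fintype VH] {d n Λ : ℕ}
    (hSG : #SG = d) (hSH : #SH = d) (hB : 0 < B) (hn : Fintype.card VH = n) (hBn : 2 * B ≤ n)
    (hnum : (5 * d + 5 : ℝ) ^ Λ * (((B : ℝ) / n) ^ ((n : ℝ) / 4) * (B : ℝ) ^ n) < 1) :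
    ∃ M : VG × VG → VH ≃ VH, ∀ code : Fin Λ → ExploreCmd SG SH B,
      (explore EG us .start (List.ofFn code)).records.Nodup →
      (∀ e, #{t ∈ (explore EG us .start (List.ofFn code)).records.toFinset | t.1 = e} ≤ B) →
      4 * (explore EG us .start (List.ofFn code)).roots + n ≤
        4 * (explore EG us .start (List.ofFn code)).closed →
      (explore EG us .start (List.ofFn code)).roots ≤ n →
      ¬ Realises (explore EG us .start (List.ofFn code)).records.toFinset M := by
  by_contra! hcon
  have hn0 : 0 < n := by omega
  have hnR : (0 : ℝ) < n := by exact_mod_cast hn0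
  have hBR : (0 : ℝ) < B := by exact_mod_cast hB
  set st : (Fin Λ → ExploreCmd SG SH B) → ExploreState VG VH :=
    fun code => explore EG us .start (List.ofFn code) with hst
  let good : Finset (Fin Λ → ExploreCmd SG SH B) := {code | (st code).records.Nodup ∧
    (∀ e, #{t ∈ (st code).records.toFinset | t.1 = e} ≤ B) ∧
    4 * (st code).roots + n ≤ 4 * (st code).closed ∧ (st code).roots ≤ n}
  set D : ℝ := ((B : ℝ) / n) ^ ((n : ℝ) / 4) * (B : ℝ) ^ n with hD
  have hT : (0 : ℝ) < Fintype.card (VG × VG → VH ≃ VH) := by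
    exact_mod_cast Fintype.card_pos
  have hcover : (univ : Finset (VG × VG → VH ≃ VH)) ⊆
      good.biUnion fun code => {M | Realises (st code).records.toFinset M} := by
    intro M _
    obtain ⟨code, h1, h2, h3, h4, h5⟩ := hcon M
    exact mem_biUnion.mpr ⟨code, mem_filter.mpr ⟨mem_univ _, h1, h2, h3, h4⟩,
      mem_filter.mpr ⟨mem_univ _, h5⟩⟩
  have hcode : ∀ code ∈ good,
      (#{M : VG × VG → VH ≃ VH | Realises (st code).records.toFinset M} : ℝ) ≤
        (Fintype.card (VG × VG → VH ≃ VH) * D) * ∏ i, cmdWeight (n : ℝ) (code i) := by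
    intro code hcode
    obtain ⟨-, h1, h2, h3, h4⟩ := mem_filter.mp hcode
    have hreal := card_realises_mul_le (st code).records.toFinset
      (fun e => by rw [hn]; have := h2 e; omega)
    have hw := prod_cmdWeight_mul EG us (List.ofFn code) hnR.ne' hB.ne'
    rw [List.map_ofFn, List.prod_ofFn] at hw
    change _ * (_ ^ ((st code).found + (st code).roots) * _ ^ (st code).closed) =
      2 ^ ((st code).found + (st code).closed) at hw
    have hlen : (st code).records.length = _ := length_records_explore EG us (List.ofFn code)
    rw [List.toFinset_card_of_nodup h1, hlen, hn] at hreal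
    change _ * _ ^ ((st code).found + (st code).closed) ≤ _ at hreal
    generalize (st code).found = f at *
    generalize (st code).closed = k at *
    generalize (st code).roots = r at *
    have hpd : (B : ℝ) ^ k * (n : ℝ) ^ r / (n : ℝ) ^ k ≤ D := by
      obtain ⟨j, rfl⟩ := Nat.exists_eq_add_of_le (show r ≤ k by omega)
      have e1 : (B : ℝ) ^ (r + j) * (n : ℝ) ^ r / (n : ℝ) ^ (r + j) =
          ((B : ℝ) / n) ^ j * (B : ℝ) ^ r := by
        rw [pow_add, pow_add, div_pow]
        field_simp
      rw [e1, hD]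
      have hle1 : (B : ℝ) / n ≤ 1 := by
        rw [div_le_one hnR]
        exact_mod_cast (by omega : B ≤ n)
      gcongr
      · rw [← Real.rpow_natCast]
        refine Real.rpow_le_rpow_of_exponent_ge (by positivity) hle1 ?_
        have : (n : ℝ) ≤ 4 * j := by exact_mod_cast (by omega : n ≤ 4 * j)
        linarith
      · exact_mod_cast hB
    have e2 : ((n : ℝ) / 2) ^ (f + k) * (∏ i, cmdWeight (n : ℝ) (code i)) *
        ((B : ℝ) ^ k * (n : ℝ) ^ r / (n : ℝ) ^ k) = 1 := by
      have hw' : (∏ i, cmdWeight (n : ℝ) (code i)) * ((n : ℝ) ^ (f + r) * (B : ℝ) ^ k) =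
        2 ^ (f + k) := hw
      rw [div_pow, ← hw', pow_add, pow_add]
      have : (∏ i, cmdWeight (n : ℝ) (code i)) ≠ 0 := by
        intro h0
        rw [h0, zero_mul] at hw'
        exact absurd hw' (by positivity)
      field_simp
    have hp0 : 0 ≤ ∏ i, cmdWeight (n : ℝ) (code i) :=
      prod_nonneg fun i _ => cmdWeight_nonneg hnR _
    set w := ∏ i, cmdWeight (n : ℝ) (code i)
    calc (#{M : VG × VG → VH ≃ VH | Realises (st code).records.toFinset M} : ℝ)
        = #{M : VG × VG → VH ≃ VH | Realises (st code).records.toFinset M} *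
          (((n : ℝ) / 2) ^ (f + k) * w * ((B : ℝ) ^ k * (n : ℝ) ^ r / (n : ℝ) ^ k)) := by
          rw [e2, mul_one]
      _ = (#{M : VG × VG → VH ≃ VH | Realises (st code).records.toFinset M} *
          ((n : ℝ) / 2) ^ (f + k)) * (w * ((B : ℝ) ^ k * (n : ℝ) ^ r / (n : ℝ) ^ k)) := by ring
      _ ≤ Fintype.card (VG × VG → VH ≃ VH) * (w * D) := by gcongr
      _ = _ := by ring
  have hsum : (Fintype.card (VG × VG → VH ≃ VH) : ℝ) ≤
      (Fintype.card (VG × VG → VH ≃ VH) * D) * (5 * d + 5) ^ Λ := by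
    calc (Fintype.card (VG × VG → VH ≃ VH) : ℝ)
        ≤ ∑ code ∈ good,
          (#{M : VG × VG → VH ≃ VH | Realises (st code).records.toFinset M} : ℝ) := by
          rw [← card_univ]
          exact_mod_cast (card_le_card hcover).trans card_biUnion_le
      _ ≤ ∑ code ∈ good,
          (Fintype.card (VG × VG → VH ≃ VH) * D) * ∏ i, cmdWeight (n : ℝ) (code i) :=
          sum_le_sum hcode
      _ ≤ ∑ code : Fin Λ → ExploreCmd SG SH B,
          (Fintype.card (VG × VG → VH ≃ VH) * D) * ∏ i, cmdWeight (n : ℝ) (code i) := by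
          refine sum_le_sum_of_subset_of_nonneg (subset_univ _) fun code _ _ => ?_
          have : 0 ≤ ∏ i, cmdWeight (n : ℝ) (code i) :=
            prod_nonneg fun i _ => cmdWeight_nonneg hnR _
          positivity
      _ = _ := by
          rw [← mul_sum, ← Fintype.sum_pow, ← hn, sum_cmdWeight hSG hSH hB (by omega)]
  have : (Fintype.card (VG × VG → VH ≃ VH) * D) * (5 * d + 5 : ℝ) ^ Λ <
      Fintype.card (VG × VG → VH ≃ VH) := by
    calc _ = Fintype.card (VG × VG → VH ≃ VH) * ((5 * d + 5 : ℝ) ^ Λ * D) := by ring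
      _ < Fintype.card (VG × VG → VH ≃ VH) * 1 := by gcongr
      _ = _ := mul_one _
  linarith

end Counting

open scoped Pointwise in
theorem SimpleGraph.Walk.inv_mul_mem_pow {α Γ : Type} [Group Γ] [DecidableEq Γ]
    {X : SimpleGraph α} (φ : α → Γ) {T : Finset Γ} (h1 : 1 ∈ T)
    (hφ : ∀ u v, X.Adj u v → (φ u)⁻¹ * φ v ∈ T) {a b : α} (p : X.Walk a b) {m : ℕ}
    (hm : p.length ≤ m) : (φ a)⁻¹ * φ b ∈ T ^ m := by
  refine Finset.pow_subset_pow_right h1 hm ?_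
  clear hm
  induction p with
  | nil => simp
  | @cons u v w hadj p ih =>
    rw [SimpleGraph.Walk.length_cons, pow_succ']
    convert Finset.mul_mem_mul (hφ _ _ hadj) ih using 1
    group

theorem SimpleGraph.Walk.forall_mem_support_of_closed {α : Type} {X : SimpleGraph α} (S : Set α)
    {a b : α} (p : X.Walk a b) (ha : a ∈ S) (h : ∀ u v, s(u, v) ∈ p.edges → u ∈ S → v ∈ S) :
    ∀ v ∈ p.support, v ∈ S := by
  induction p with
  | nil => simpa using ha
  | @cons u v w hadj p ih =>
    intro x hx
    rw [SimpleGraph.Walk.support_cons, List.mem_cons] at hx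
    rcases hx with rfl | hx
    · exact ha
    · refine ih (h u v (by simp) ha) (fun y z hyz => h y z ?_) x hx
      rw [SimpleGraph.Walk.edges_cons]
      exact List.mem_cons_of_mem _ hyz

section Walks

variable {X : SimpleGraph (VG × VH)} {G : SimpleGraph VG} (G' : G.Subgraph) (f : VG → VG × VH)
  (P : ∀ {g₁ g₂ : VG}, G'.Adj g₁ g₂ → X.Walk (f g₁) (f g₂))

/-- The graph formed by the edges of the walks `P`. -/
def walkGraph : SimpleGraph (VG × VH) where
  Adj u v := ∃ (g₁ g₂ : VG) (h : G'.Adj g₁ g₂), s(u, v) ∈ (P h).edges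
  symm := ⟨fun u v ⟨g₁, g₂, h, he⟩ => ⟨g₁, g₂, h, by rwa [Sym2.eq_swap]⟩⟩
  loopless := ⟨fun u ⟨g₁, g₂, h, he⟩ => X.loopless.irrefl u ((P h).adj_of_mem_edges he)⟩

/-- The subgraph of `walkGraph` formed by the intra-cloud edges. -/
def intraWalkGraph : SimpleGraph (VG × VH) where
  Adj u v := (walkGraph G' f P).Adj u v ∧ u.1 = v.1
  symm := ⟨fun _ _ h => ⟨h.1.symm, h.2.symm⟩⟩
  loopless := ⟨fun u h => (walkGraph G' f P).loopless.irrefl u h.1⟩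

variable [DecidableEq VG] [DecidableEq VH] [Group VG] (SG : Finset VG)

open Classical in
/-- The vertices of the walks `P` starting at `f g`. -/
def walkVertsAt (g : VG) : Finset (VG × VH) :=
  if g ∈ G'.verts then
    insert (f g) (SG.biUnion fun s =>
      if h : G'.Adj g (g * s) then (P h).support.toFinset else ∅)
  else ∅

variable {G' f P SG}

theorem mem_walkVertsAt_self {g : VG} (hg : g ∈ G'.verts) : f g ∈ walkVertsAt G' f P SG g := by
  simp [walkVertsAt, hg]

theorem mem_walkVertsAt (hSG : ∀ a b, G.Adj a b → a⁻¹ * b ∈ SG) {g₁ g₂ : VG} (h : G'.Adj g₁ g₂)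
    {v : VG × VH} (hv : v ∈ (P h).support) : v ∈ walkVertsAt G' f P SG g₁ := by
  rw [walkVertsAt, if_pos (G'.edge_vert h), mem_insert, mem_biUnion]
  obtain ⟨s, rfl⟩ : ∃ s, g₂ = g₁ * s := ⟨g₁⁻¹ * g₂, by group⟩
  have hs := hSG _ _ h.adj_sub
  rw [inv_mul_cancel_left] at hs
  exact .inr ⟨s, hs, by simp [h, hv]⟩

theorem exists_of_mem_walkVertsAt {g : VG} {v : VG × VH} (hv : v ∈ walkVertsAt G' f P SG g) :
    g ∈ G'.verts ∧ (v = f g ∨ ∃ (g₂ : VG) (h : G'.Adj g g₂), v ∈ (P h).support) := by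
  unfold walkVertsAt at hv
  split_ifs at hv with hg
  · refine ⟨hg, ?_⟩
    rcases mem_insert.mp hv with hv | hv
    · exact .inl hv
    · obtain ⟨s, -, hs⟩ := mem_biUnion.mp hv
      split_ifs at hs with h
      · exact .inr ⟨_, h, List.mem_toFinset.mp hs⟩
      · simp at hs
  · simp at hv

theorem card_walkVertsAt_le {d ℓ : ℕ} (hd : #SG = d)
    (hlen : ∀ g₁ g₂ (h : G'.Adj g₁ g₂), (P h).length ≤ ℓ) (g : VG) :
    #(walkVertsAt G' f P SG g) ≤ (d + 1) * (ℓ + 1) := by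
  classical
  unfold walkVertsAt
  split_ifs
  · refine (card_insert_le _ _).trans ?_
    have : #(SG.biUnion fun s => if h : G'.Adj g (g * s) then (P h).support.toFinset else ∅) ≤
        #SG * (ℓ + 1) := by
      refine card_biUnion_le_card_mul _ _ _ fun s _ => ?_
      split_ifs with h
      · refine (List.toFinset_card_le _).trans ?_
        rw [SimpleGraph.Walk.length_support]
        exact Nat.succ_le_succ (hlen _ _ h)
      · simp
    rw [hd] at this
    nlinarith
  · simp

open scoped Pointwise in
/-- A vertex of the walks starting at `f g` lies in a cloud near `g`. -/
theorem inv_mul_fst_mem_pow {ℓ : ℕ} (hG : G.Connected)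
    (hSG : ∀ a b, G.Adj a b → a⁻¹ * b ∈ SG)
    (hX : ∀ u v, X.Adj u v → u.1⁻¹ * v.1 ∈ insert 1 SG)
    (hlen : ∀ g₁ g₂ (h : G'.Adj g₁ g₂), (P h).length ≤ ℓ)
    (hdist : ∀ g ∈ G'.verts, G.dist g (f g).1 ≤ ℓ) {g : VG} {v : VG × VH}
    (hv : v ∈ walkVertsAt G' f P SG g) : g⁻¹ * v.1 ∈ (insert 1 SG) ^ (2 * ℓ) := by
  classical
  obtain ⟨hg, hv⟩ := exists_of_mem_walkVertsAt hv
  have h1 : g⁻¹ * (f g).1 ∈ (insert 1 SG) ^ ℓ := by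
    obtain ⟨p, hp⟩ := hG.exists_walk_length_eq_dist g (f g).1
    exact p.inv_mul_mem_pow id (mem_insert_self _ _)
      (fun u v h => mem_insert_of_mem (hSG u v h)) (hp ▸ hdist g hg)
  have h2 : (f g).1⁻¹ * v.1 ∈ (insert 1 SG) ^ ℓ := by
    rcases hv with rfl | ⟨g₂, h, hv⟩
    · rw [inv_mul_cancel]
      exact Finset.one_mem_pow (mem_insert_self _ _)
    · exact ((P h).takeUntil v hv).inv_mul_mem_pow Prod.fst (mem_insert_self _ _) hX
        (((P h).length_takeUntil_le_length hv).trans (hlen _ _ h))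
  rw [two_mul, pow_add]
  convert Finset.mul_mem_mul h1 h2 using 1
  group

open scoped Pointwise in
theorem card_filter_walkVerts_le [Fintype VG] {d ℓ : ℕ}
    (hd : #SG = d) (hG : G.Connected)
    (hSG : ∀ a b, G.Adj a b → a⁻¹ * b ∈ SG)
    (hX : ∀ u v, X.Adj u v → u.1⁻¹ * v.1 ∈ insert 1 SG)
    (hlen : ∀ g₁ g₂ (h : G'.Adj g₁ g₂), (P h).length ≤ ℓ)
    (hdist : ∀ g ∈ G'.verts, G.dist g (f g).1 ≤ ℓ) (u : VG) :
    #{v ∈ univ.biUnion (walkVertsAt G' f P SG) | v.1 = u} ≤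
      (d + 1) ^ (2 * ℓ) * ((d + 1) * (ℓ + 1)) := by
  have hsub : {v ∈ univ.biUnion (walkVertsAt G' f P SG) | v.1 = u} ⊆
      ((insert 1 SG) ^ (2 * ℓ)).biUnion fun t => walkVertsAt G' f P SG (u * t⁻¹) := by
    intro v hv
    obtain ⟨hvW, rfl⟩ := mem_filter.mp hv
    obtain ⟨g, -, hg⟩ := mem_biUnion.mp hvW
    refine mem_biUnion.mpr ⟨_, inv_mul_fst_mem_pow hG hSG hX hlen hdist hg, ?_⟩
    convert hg using 2
    group
  refine (card_le_card hsub).trans ((card_biUnion_le_card_mul _ _ _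
    fun t _ => card_walkVertsAt_le hd hlen _).trans ?_)
  gcongr
  refine Finset.card_pow_le.trans ?_
  gcongr
  rw [← hd]
  exact card_insert_le _ _

theorem card_walkVerts_le [Fintype VG] {d ℓ : ℕ}
    (hd : #SG = d) (hlen : ∀ g₁ g₂ (h : G'.Adj g₁ g₂), (P h).length ≤ ℓ) :
    #(univ.biUnion (walkVertsAt G' f P SG)) ≤ Fintype.card VG * ((d + 1) * (ℓ + 1)) :=
  card_biUnion_le_card_mul _ _ _ fun _ _ => card_walkVertsAt_le hd hlen _

end Walks

section ExtGraph

variable {G : SimpleGraph VG} {H : SimpleGraph VH} {EG : Finset (VG × VG)}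
  {M : VG × VG → VH ≃ VH}

theorem ExtGraph.adj_snd_of_fst_eq (hEG : IsOrientation G EG) {u v : VG × VH}
    (h : (ExtGraph H EG M).Adj u v) (huv : u.1 = v.1) : H.Adj u.2 v.2 := by
  have hirr : ∀ w, (w, w) ∉ EG := fun w hw => G.loopless.irrefl w (hEG.1 _ hw)
  rw [ExtGraph, SimpleGraph.fromRel_adj] at h
  rcases h.2 with (h | h) | (h | h)
  · exact h.2
  · exact absurd (huv ▸ h.1) (hirr _)
  · exact h.2.symm
  · exact absurd (huv ▸ h.1) (hirr _)

theorem ExtGraph.adj_fst_of_fst_ne (hEG : IsOrientation G EG) {u v : VG × VH}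
    (h : (ExtGraph H EG M).Adj u v) (huv : u.1 ≠ v.1) : G.Adj u.1 v.1 := by
  rw [ExtGraph, SimpleGraph.fromRel_adj] at h
  rcases h.2 with (h | h) | (h | h)
  · exact absurd h.1 huv
  · exact hEG.1 _ h.1
  · exact absurd h.1.symm huv
  · exact (hEG.1 _ h.1).symm

theorem ExtGraph.apply_interRecord [DecidableEq VG] (hEG : IsOrientation G EG) {u v : VG × VH}
    (h : (ExtGraph H EG M).Adj u v) (huv : u.1 ≠ v.1) :
    M (interRecord EG u v).1 (interRecord EG u v).2.1 = (interRecord EG u v).2.2 := by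
  have hor := hEG.2 _ _ (ExtGraph.adj_fst_of_fst_ne hEG h huv)
  rw [ExtGraph, SimpleGraph.fromRel_adj] at h
  unfold interRecord
  split_ifs with he
  · rcases h.2 with (h | h) | (h | h)
    · exact absurd h.1 huv
    · exact h.2.symm
    · exact absurd h.1.symm huv
    · exact absurd h.1 (hor.mp he)
  · rcases h.2 with (h | h) | (h | h)
    · exact absurd h.1 huv
    · exact absurd h.1 he
    · exact absurd h.1.symm huv
    · exact h.2.symm

/-- The endpoint of the inter-cloud edge from `u` to the cloud of `u.1 * s`. -/
def interPartner [DecidableEq VG] [Group VG] (EG : Finset (VG × VG)) (M : VG × VG → VH ≃ VH)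
    (u : VG × VH) (s : VG) : VG × VH :=
  (u.1 * s, if (u.1, u.1 * s) ∈ EG then M (u.1, u.1 * s) u.2 else (M (u.1 * s, u.1)).symm u.2)

theorem ExtGraph.eq_interPartner [DecidableEq VG] [Group VG] (hEG : IsOrientation G EG)
    {u v : VG × VH} (h : (ExtGraph H EG M).Adj u v) (huv : u.1 ≠ v.1) :
    interPartner EG M u (u.1⁻¹ * v.1) = v := by
  have h1 := ExtGraph.apply_interRecord hEG h huv
  unfold interPartner interRecord at *
  rw [mul_inv_cancel_left]
  refine Prod.ext rfl ?_
  split_ifs at h1 ⊢ with he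
  · exact h1
  · rw [Equiv.symm_apply_eq]
    exact h1.symm

end ExtGraph

section Encoding

variable {G : SimpleGraph VG} {H : SimpleGraph VH} {EG : Finset (VG × VG)}
  {M : VG × VG → VH ≃ VH} [DecidableEq VG] [DecidableEq VH] [Group VG] [Group VH]
  {SG : Finset VG} {SH : Finset VH} {B : ℕ}

omit [DecidableEq VH] in
theorem exists_ofFn_eq_explore (us : List VG) (st : ExploreState VG VH)
    (code : List (ExploreCmd SG SH B)) {Λ : ℕ} (h : code.length ≤ Λ) :
    ∃ code' : Fin Λ → ExploreCmd SG SH B,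
      explore EG us st (List.ofFn code') = explore EG us st code := by
  obtain ⟨m, rfl⟩ := Nat.exists_eq_add_of_le h
  set c : List (ExploreCmd SG SH B) :=
    code ++ List.replicate m (.inr (.inr (.inr (.inr 3)))) with hc
  have hlen : c.length = code.length + m := by simp [hc]
  refine ⟨fun i => c.get (i.cast hlen.symm), ?_⟩
  have hofFn : List.ofFn (fun i : Fin (code.length + m) => c.get (i.cast hlen.symm)) = c := by
    apply List.ext_getElem <;> simp [hlen]
  rw [hofFn, hc, explore, List.foldl_append]
  exact explore_replicate_nop EG us _ m

/-- The walks of a split can be explored by a short code that closes many more inter-cloud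
edges than it uses roots, and whose records are all realised by `M`. -/
theorem exists_code_of_split [Fintype VG] [Fintype VH] {d ℓ n : ℕ} (hn : Fintype.card VG = n)
    (hd : #SG = d) (hG : G.Connected)
    (hSG : ∀ a b, G.Adj a b → a⁻¹ * b ∈ SG) (hSH : ∀ a b, H.Adj a b → a⁻¹ * b ∈ SH)
    (hEG : IsOrientation G EG) (G' : G.Subgraph) (f : VG → VG × VH)
    (P : ∀ {g₁ g₂ : VG}, G'.Adj g₁ g₂ → (ExtGraph H EG M).Walk (f g₁) (f g₂))
    (hom : IsCycleHomeo G' (fun {_ _} hadj => projEdges (P hadj)))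
    (hlen : ∀ g₁ g₂ (h : G'.Adj g₁ g₂), (P h).length ≤ ℓ)
    (hdist : ∀ g ∈ G'.verts, G.dist g (f g).1 ≤ ℓ)
    (hE : 5 * n ≤ 4 * G'.edgeSet.ncard)
    (hB : (d + 1) ^ (2 * ℓ) * ((d + 1) * (ℓ + 1)) = B) :
    ∃ code : Fin ((d + 3) * (n * ((d + 1) * (ℓ + 1))) + n) → ExploreCmd SG SH B,
      (explore EG univ.toList .start (List.ofFn code)).records.Nodup ∧
      (∀ e, #{t ∈ (explore EG univ.toList .start (List.ofFn code)).records.toFinset | t.1 = e}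
        ≤ B) ∧
      4 * (explore EG univ.toList .start (List.ofFn code)).roots + n ≤
        4 * (explore EG univ.toList .start (List.ofFn code)).closed ∧
      (explore EG univ.toList .start (List.ofFn code)).roots ≤ n ∧
      Realises (explore EG univ.toList .start (List.ofFn code)).records.toFinset M := by
  classical
  set W : Finset (VG × VH) := univ.biUnion (walkVertsAt G' f P SG) with hW
  set Y := walkGraph G' f P with hY
  set Rt : Finset (VG × VH) := (univ.filter (· ∈ G'.verts)).image f with hRt
  set comp : VG × VH → (intraWalkGraph G' f P).ConnectedComponent :=
    (intraWalkGraph G' f P).connectedComponentMk with hcomp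
  set K : Finset ((VG × VG) × VH × VH) :=
    (W ×ˢ SG).image (fun p => interRecord EG p.1 (interPartner EG M p.1 p.2)) with hK
  have hX : ∀ u v, (ExtGraph H EG M).Adj u v → u.1⁻¹ * v.1 ∈ insert 1 SG := by
    intro u v h
    by_cases huv : u.1 = v.1
    · simp [huv]
    · exact mem_insert_of_mem (hSG _ _ (ExtGraph.adj_fst_of_fst_ne hEG h huv))
  have hYX : ∀ u v, Y.Adj u v → (ExtGraph H EG M).Adj u v := by
    rintro u v ⟨g₁, g₂, h, he⟩
    exact (P h).adj_of_mem_edges he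
  have hYW : ∀ u v, Y.Adj u v → v ∈ W := by
    rintro u v ⟨g₁, g₂, h, he⟩
    exact mem_biUnion.mpr ⟨g₁, mem_univ _,
      mem_walkVertsAt hSG h ((P h).snd_mem_support_of_mem_edges he)⟩
  have hRtW : Rt ⊆ W := by
    intro v hv
    obtain ⟨g, hg, rfl⟩ := mem_image.mp hv
    exact mem_biUnion.mpr ⟨g, mem_univ _, mem_walkVertsAt_self (mem_filter.mp hg).2⟩
  have hcompY : ∀ u v, Y.Adj u v → u.1 = v.1 → comp u = comp v := fun u v h e =>
    SimpleGraph.ConnectedComponent.sound (SimpleGraph.Adj.reachable ⟨h, e⟩)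
  have hcompS : ∀ S : Set (VG × VH), (∀ u ∈ S, ∀ v, Y.Adj u v → u.1 = v.1 → v ∈ S) →
      ∀ u v, comp u = comp v → u ∈ S → v ∈ S := by
    intro S hS u v huv hu
    obtain ⟨p⟩ := SimpleGraph.ConnectedComponent.exact huv
    refine p.forall_mem_support_of_closed S hu (fun x y hxy hx => ?_) v p.end_mem_support
    have := p.adj_of_mem_edges hxy
    exact hS x hx y this.1 this.2
  have hYK : ∀ u v, Y.Adj u v → u.1 ≠ v.1 → interRecord EG u v ∈ K := by
    intro u v h huv
    have hX' := hYX u v h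
    refine mem_image.mpr ⟨(u, u.1⁻¹ * v.1), mem_product.mpr ⟨hYW v u h.symm,
      hSG _ _ (ExtGraph.adj_fst_of_fst_ne hEG hX' huv)⟩, ?_⟩
    simp only [ExtGraph.eq_interPartner hEG hX' huv]
  have hBW : ∀ g, #{v ∈ W | v.1 = g} ≤ B := fun g =>
    hB ▸ card_filter_walkVerts_le hd hG hSG hX hlen hdist g
  have hWc : #W ≤ n * ((d + 1) * (ℓ + 1)) := hn ▸ card_walkVerts_le hd hlen
  have hKc : #K ≤ #W * d := by
    rw [← hd, ← card_product]
    exact card_image_le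
  have hus : (univ : Finset VG).toList.length = n := by rw [length_toList, card_univ, hn]
  obtain ⟨code₀, hcode₀, inv, ha, hb, hc⟩ := ExploreInv.exists_code (EG := EG)
    (us := (univ : Finset VG).toList) (SG := SG) (SH := SH) (B := B) hcompY hcompS hYW hRtW
    (fun u v h e => hSH _ _ (ExtGraph.adj_snd_of_fst_eq hEG (hYX u v h) e))
    (fun u v h e => hSG _ _ (ExtGraph.adj_fst_of_fst_ne hEG (hYX u v h) e)) hBW hYK
    ExploreInv.start
  have hlen₀ : code₀.length ≤ (d + 3) * (n * ((d + 1) * (ℓ + 1))) + n := by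
    rw [hus] at hcode₀
    have : #W * (d + 3) ≤ n * ((d + 1) * (ℓ + 1)) * (d + 3) := Nat.mul_le_mul_right _ hWc
    rw [mul_comm (d + 3)]
    linarith [Nat.zero_le (ExploreState.progress (ExploreState.start : ExploreState VG VH))]
  obtain ⟨code, hcode⟩ := exists_ofFn_eq_explore (EG := EG) (univ : Finset VG).toList .start code₀
    hlen₀
  refine ⟨code, ?_⟩
  have hrec := length_records_explore EG (univ : Finset VG).toList code₀
  rw [hcode]
  generalize explore EG (univ : Finset VG).toList .start code₀ = st at *
  have hreal : Realises st.records.toFinset M := by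
    intro t ht
    obtain ⟨u, -, v, -, h, e, rfl⟩ := inv.records_spec t (List.mem_toFinset.mp ht)
    exact ExtGraph.apply_interRecord hEG (hYX u v h) e
  have hintra := inv.intra_closed
  have hinter := inv.inter_closed
  have hroot := inv.root_closed
  rw [ha, List.take_length] at hintra
  rw [hb, List.take_length] at hinter
  rw [hc, List.take_length] at hroot
  have hRtv : ∀ g ∈ G'.verts, f g ∈ st.verts := fun g hg =>
    hroot _ (mem_toList.mpr (mem_univ _)) _
      (mem_image.mpr ⟨g, mem_filter.mpr ⟨mem_univ _, hg⟩, rfl⟩) rfl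
  have hsupp : ∀ g₁ g₂ (h : G'.Adj g₁ g₂), ∀ v ∈ (P h).support, v ∈ st.verts := by
    intro g₁ g₂ h
    refine (P h).forall_mem_support_of_closed {v | v ∈ st.verts} (hRtv g₁ (G'.edge_vert h)) ?_
    intro u v huv hu
    by_cases e : u.1 = v.1
    · exact hintra u hu v ⟨g₁, g₂, h, huv⟩ e
    · exact (hinter u hu v ⟨g₁, g₂, h, huv⟩ e).1
  have heuler := ncard_edgeSet_add_card_le (P := P) (K := st.records.toFinset.image recordEdge)
    hom (fun g₁ g₂ h e he hdiag => by
      induction e using Sym2.ind with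
      | _ u v =>
        have hne : u.1 ≠ v.1 := by simpa using hdiag
        refine mem_image.mpr ⟨interRecord EG u v, List.mem_toFinset.mpr ?_,
          recordEdge_interRecord EG u v⟩
        exact (hinter u (hsupp _ _ h u ((P h).fst_mem_support_of_mem_edges he)) v
          ⟨g₁, g₂, h, he⟩ hne).2)
    comp (fun g₁ g₂ h u v he huv => hcompY u v ⟨g₁, g₂, h, he⟩ huv)
    (st.verts.map comp).toFinset (fun c hc => by
      obtain ⟨v, hv, rfl⟩ := List.mem_map.mp (List.mem_toFinset.mp hc)
      obtain ⟨g, -, hg⟩ := mem_biUnion.mp (inv.subset v hv)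
      obtain ⟨-, hv | ⟨g₂, h, hv⟩⟩ := exists_of_mem_walkVertsAt hg
      · exact ⟨v, rfl, .inl ⟨g, hv⟩⟩
      · exact ⟨v, rfl, .inr ⟨g, g₂, h, hv⟩⟩)
  have hcard : #(st.records.toFinset.image recordEdge) ≤ st.found + st.closed :=
    card_image_le.trans ((List.toFinset_card_le _).trans hrec.le)
  rw [inv.card_comp, hn] at heuler
  refine ⟨inv.records_nodup, ?_, by omega, ?_, hreal⟩
  · intro e
    refine (card_le_card_of_injOn (fun t => (t.1.1, t.2.1)) ?_ ?_).trans (hBW e.1)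
    · intro t ht
      rw [coe_filter, Set.mem_ofPred_eq, List.mem_toFinset] at ht
      obtain ⟨ht, rfl⟩ := ht
      obtain ⟨u, hu, v, hv, h, hne, rfl⟩ := inv.records_spec t ht
      rw [coe_filter, Set.mem_ofPred_eq]
      refine ⟨?_, rfl⟩
      unfold interRecord
      split_ifs
      · exact inv.subset u hu
      · exact inv.subset v hv
    · intro t ht t' ht' heq
      rw [coe_filter, Set.mem_ofPred_eq] at ht ht'
      have h1 := hreal t ht.1
      have h2 := hreal t' ht'.1
      have h3 : t.2.1 = t'.2.1 := congrArg Prod.snd heq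
      rw [ht.2] at h1
      rw [ht'.2, ← h3, h1] at h2
      exact Prod.ext (ht.2.trans ht'.2.symm) (Prod.ext h3 h2)
  · refine inv.roots_le.trans ?_
    rw [← List.toFinset_card_of_nodup (inv.nodup.filter _), ← hn, ← card_univ]
    refine (card_le_card (t := Rt) fun v hv => ?_).trans
      (card_image_le.trans (card_le_card (filter_subset _ _)))
    rw [List.mem_toFinset, List.mem_filter] at hv
    simpa using hv.2

end Encoding

theorem walk_length_le_floor [DecidableEq VG] {X : SimpleGraph (VG × VH)} {a b : VG × VH}
    (p : X.Walk a b) {n : ℕ} {ε : ℝ} (hL : 1 ≤ Real.log n)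
    (h : walkCost (extLen n) p < ε * Real.log n ^ ((4 : ℝ) / 3)) :
    p.length ≤ ⌊ε * Real.log n⌋₊ := by
  set L := Real.log n
  have hL0 : 0 < L := by linarith
  have hedge : ∀ e : Sym2 (VG × VH), L ^ ((1 : ℝ) / 3) ≤ extLen n e := by
    intro e
    unfold extLen
    split_ifs
    · exact le_rfl
    · exact Real.rpow_le_rpow_of_exponent_le hL (by norm_num)
  have hcost : p.length * L ^ ((1 : ℝ) / 3) ≤ walkCost (extLen n) p := by
    rw [walkCost, ← p.length_edges, ← nsmul_eq_mul, ← List.length_map (f := extLen n)]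
    refine List.card_nsmul_le_sum _ _ fun x hx => ?_
    obtain ⟨e, -, rfl⟩ := List.mem_map.mp hx
    exact hedge e
  have hsplit : L ^ ((4 : ℝ) / 3) = L * L ^ ((1 : ℝ) / 3) := by
    rw [← Real.rpow_one_add' hL0.le (by norm_num)]
    norm_num
  refine Nat.le_floor (le_of_mul_le_mul_right ?_ (Real.rpow_pos_of_pos hL0 ((1 : ℝ) / 3)))
  rw [hsplit] at h
  linarith

theorem two_mul_ncard_edgeSet_of_ncard_neighborSet {V : Type} [Fintype V] (G : SimpleGraph V)
    {d : ℕ} (h : ∀ v, (G.neighborSet v).ncard = d) :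
    2 * G.edgeSet.ncard = Fintype.card V * d := by
  classical
  rw [Set.ncard_eq_toFinset_card', ← SimpleGraph.edgeFinset, ← G.sum_degrees_eq_twice_card_edges,
    Finset.sum_congr rfl (g := fun _ => d), sum_const, card_univ, smul_eq_mul]
  intro v _
  rw [← h v, Set.ncard_eq_toFinset_card', Set.toFinset_card, SimpleGraph.card_neighborSet_eq_degree]

/-- The numerical estimate behind the counting argument. -/
theorem exists_eps_forall_counting_bound (d : ℕ) :
    ∃ ε₀ : ℝ, 0 < ε₀ ∧ ∀ ε : ℝ, 0 < ε → ε < ε₀ → ∃ N : ℕ, ∀ n : ℕ, N ≤ n → ∀ ℓ B : ℕ,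
      ℓ = ⌊ε * Real.log n⌋₊ → B = (d + 1) ^ (2 * ℓ) * ((d + 1) * (ℓ + 1)) →
      1 ≤ Real.log n ∧ 2 * B ≤ n ∧
      (5 * d + 5 : ℝ) ^ ((d + 3) * (n * ((d + 1) * (ℓ + 1))) + n) *
        (((B : ℝ) / n) ^ ((n : ℝ) / 4) * (B : ℝ) ^ n) < 1 := by
  set a := Real.log (d + 1) with ha
  set c := Real.log (5 * d + 5) with hc
  have ha0 : 0 ≤ a := Real.log_nonneg (by linarith [(Nat.cast_nonneg d : (0 : ℝ) ≤ d)])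
  have hc0 : 0 < c := Real.log_pos (by linarith [(Nat.cast_nonneg d : (0 : ℝ) ≤ d)])
  set C₁ : ℝ := (d + 3) * (d + 1) * c + 5 / 4 * (2 * a + 1) with hC₁
  set C₂ : ℝ := ((d + 3) * (d + 1) + 1) * c + 5 / 4 * a with hC₂
  have hC₁0 : 0 < C₁ := by positivity
  have hC₂0 : 0 < C₂ := by positivity
  refine ⟨1 / (8 * C₁), by positivity, fun ε hε hε₀ => ⟨⌈Real.exp (8 * C₂ + 4)⌉₊, ?_⟩⟩
  rintro n hn ℓ B hℓ hB
  set L := Real.log n with hL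
  have hexp : Real.exp (8 * C₂ + 4) ≤ n := Nat.ceil_le.mp hn
  have hn0 : (0 : ℝ) < n := (Real.exp_pos _).trans_le hexp
  have hLC : 8 * C₂ + 4 ≤ L := (Real.le_log_iff_exp_le hn0).mpr hexp
  have hℓL : (ℓ : ℝ) ≤ ε * L := hℓ ▸ Nat.floor_le (by positivity)
  have hC₁ℓ : C₁ * ℓ ≤ L / 8 := by
    have : ε * (8 * C₁) < 1 := (lt_div_iff₀ (by positivity)).mp hε₀
    nlinarith
  have hB0 : 0 < B := by rw [hB]; positivity
  have hBR : (0 : ℝ) < B := by exact_mod_cast hB0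
  have hlogB : Real.log B ≤ (2 * a + 1) * ℓ + a := by
    have h1 : Real.log (ℓ + 1) ≤ ℓ := by
      have := Real.log_le_sub_one_of_pos (show (0 : ℝ) < ℓ + 1 by positivity)
      linarith
    rw [hB]
    push_cast
    rw [Real.log_mul (by positivity) (by positivity), Real.log_mul (by positivity) (by positivity),
      Real.log_pow]
    push_cast
    linarith
  have hmain : ((d + 3) * (d + 1) * (ℓ + 1) + 1) * c + 5 / 4 * Real.log B < L / 4 := by
    have : ((d + 3) * (d + 1) * (ℓ + 1) + 1) * c + 5 / 4 * ((2 * a + 1) * ℓ + a) =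
      C₁ * ℓ + C₂ := by rw [hC₁, hC₂]; ring
    linarith
  refine ⟨by linarith, ?_, ?_⟩
  · have h2 : Real.log (2 * B) ≤ L := by
      rw [Real.log_mul (by norm_num) hBR.ne']
      have h3 := Real.log_le_sub_one_of_pos (show (0 : ℝ) < 2 by norm_num)
      have h4 : 0 ≤ ((d + 3) * (d + 1) * (ℓ + 1) + 1) * c := by positivity
      linarith
    have := (Real.log_le_log_iff (by positivity) hn0).mp h2
    exact_mod_cast this
  · rw [← Real.log_neg_iff (by positivity), Real.log_mul (by positivity) (by positivity),
      Real.log_mul (by positivity) (by positivity), Real.log_pow, Real.log_pow,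
      Real.log_rpow (by positivity), Real.log_div hBR.ne' hn0.ne']
    push_cast
    have : ((d + 3) * (n * ((d + 1) * (ℓ + 1))) + n) * c +
        (n / 4 * (Real.log B - L) + n * Real.log B) =
        n * (((d + 3) * (d + 1) * (ℓ + 1) + 1) * c + 5 / 4 * Real.log B - L / 4) := by ring
    rw [this]
    exact mul_neg_of_pos_of_neg hn0 (by linarith)

/-- No splits: for `d ≥ 3` and `h, γ > 0` there is `ε₀ > 0` (depending only on
`d, h, γ`) such that for every `ε ∈ (0, ε₀)` and every sufficiently large `n`, for every
pair `(G, H)` satisfying the hypotheses and every orientation of the edges of `G`, there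
exists a family `M` of bijections such that the extension graph `X(G,H,M)` admits no map
`f̄` that is an `(ε·(log n)^{4/3}, ε)`-split. -/
theorem no_split_exists (d : ℕ) (hd : 3 ≤ d) (h γ : ℝ) (hh : 0 < h) (hγ : 0 < γ) :
    ∃ ε₀ : ℝ, 0 < ε₀ ∧
      ∀ ε : ℝ, 0 < ε → ε < ε₀ →
      ∃ N : ℕ, ∀ n : ℕ, N ≤ n →
        ∀ (VG VH : Type) [Fintype VG] [Fintype VH] [DecidableEq VG] [DecidableEq VH]
          [Group VG] [Group VH] (G : SimpleGraph VG) (H : SimpleGraph VH),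
          GoodPair d h γ n G H →
          ∀ EG : Finset (VG × VG), IsOrientation G EG →
          ∃ M : VG × VG → VH ≃ VH,
            ¬ ∃ (G' : G.Subgraph) (fbar : VG → VG × VH),
                IsSplit n G H EG M (ε * Real.log n ^ ((4 : ℝ) / 3)) ε G' fbar := by
  obtain ⟨ε₁, hε₁, hnum⟩ := exists_eps_forall_counting_bound d
  refine ⟨min ε₁ (1 / 6), by positivity, fun ε hε hεlt => ?_⟩
  obtain ⟨N, hN⟩ := hnum ε hε (hεlt.trans_le (min_le_left _ _))
  refine ⟨N, fun n hn VG VH _ _ _ _ _ _ G H hgood EG hEG => ?_⟩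
  obtain ⟨hcG, hcH, hG, -, hreg, -, ⟨SG, hSGc, -, -, hSG⟩, ⟨SH, hSHc, -, -, hSH⟩, -⟩ := hgood
  obtain ⟨hL, hBn, hbound⟩ := hN n hn _ _ rfl rfl
  obtain ⟨M, hM⟩ := exists_not_realises EG (univ : Finset VG).toList hSGc hSHc (by positivity) hcH
    hBn hbound
  refine ⟨M, ?_⟩
  rintro ⟨G', f, hcard, ⟨P, hP, hom⟩, hlt, hdist⟩
  have hE : 5 * n ≤ 4 * G'.edgeSet.ncard := by
    have h1 := two_mul_ncard_edgeSet_of_ncard_neighborSet G hreg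
    rw [hcG] at h1
    have h2 : (3 : ℝ) * n ≤ 2 * G.edgeSet.ncard := by
      have : 3 * n ≤ 2 * G.edgeSet.ncard := by
        rw [h1, mul_comm]
        exact Nat.mul_le_mul_left _ hd
      exact_mod_cast this
    have h3 : ε ≤ 1 / 6 := (hεlt.trans_le (min_le_right _ _)).le
    have h4 : (5 : ℝ) / 6 * G.edgeSet.ncard ≤ (1 - ε) * G.edgeSet.ncard := by
      gcongr
      linarith
    have h5 : (5 : ℝ) * n ≤ 4 * G'.edgeSet.ncard := by linarith
    exact_mod_cast h5
  obtain ⟨code, h1, h2, h3, h4, h5⟩ := exists_code_of_split hcG hSGc hG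
    (fun a b => (hSG a b).mp) (fun a b => (hSH a b).mp) hEG G' f P hom
    (fun g₁ g₂ hadj => walk_length_le_floor (P hadj) hL (by rw [hP]; exact hlt hadj))
    (fun g hg => Nat.le_floor (hdist g hg)) hE rfl
  exact hM code h1 h2 h3 h4 h5
end
end

section
/- Let G be a finite simple graph whose girth is at least g (i.e., every cycle in G has length at least g). Let W be a closed walk in G (a walk whose first and last vertices coincide) whose length (number of edge-traversals) is strictly less than g. Then every edge of G is traversed an even number of times by W, i.e., every edge appears an even number of times in the list of edges of W. -/
namespace SimpleGraph.Walk

variable {V : Type*} {G : SimpleGraph V} {u v : V}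

/-- A path closed up by an edge `s(u, v)` that it traverses is that edge traversed back and
forth. -/
theorem IsPath.even_count_edges_cons [DecidableEq V] {p : G.Walk v u} (hp : p.IsPath)
    (h : G.Adj u v) (hmem : s(u, v) ∈ p.edges) (e : Sym2 V) :
    Even ((cons h p).edges.count e) := by
  obtain rfl : p = h.symm.toWalk := hp.eq_adj_toWalk_of_mem_edges (Sym2.eq_swap ▸ hmem)
  by_cases he : s(u, v) = e <;> simp [Sym2.eq_swap (a := v), he]

/-- If all cycles have length at least `g`, then bypassing preserves the parity of the number of
traversals of each edge for walks of length less than `g`. -/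
theorem even_count_edges_add_count_edges_bypass [DecidableEq V] {g : ℕ}
    (hg : ∀ (v : V) (c : G.Walk v v), c.IsCycle → g ≤ c.length)
    (p : G.Walk u v) (hp : p.length < g) (e : Sym2 V) :
    Even (p.edges.count e + p.bypass.edges.count e) := by
  induction p with
  | nil => simp [bypass]
  | @cons u w v h p ih =>
    rw [length_cons] at hp
    have ih := ih (by omega)
    by_cases hu : u ∈ p.bypass.support
    · have hpath := p.bypass_isPath.takeUntil hu
      have hmem : s(u, w) ∈ (p.bypass.takeUntil u hu).edges := by
        by_contra hmem
        have hlen := hg u _ ((cons_isCycle_iff _ h).mpr ⟨hpath, hmem⟩)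
        have := p.bypass.length_takeUntil_le_length hu
        have := p.length_bypass_le_length
        rw [length_cons] at hlen
        omega
      have heven := hpath.even_count_edges_cons h hmem e
      have hsplit := congrArg (List.count e ∘ edges) (p.bypass.take_spec hu)
      simp only [Function.comp_apply, edges_append, List.count_append] at hsplit
      simp only [bypass, dif_pos hu, edges_cons, List.count_cons] at heven ⊢
      grind
    · simp only [bypass, dif_neg hu, edges_cons, List.count_cons]
      grind

end SimpleGraph.Walk

/-- In a graph whose girth is at least `g` (every cycle has length at least `g`), every
closed walk of length strictly less than `g` traverses every edge an even number of
times. -/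
theorem closed_walk_short_even_edges {V : Type} [DecidableEq V] (G : SimpleGraph V) (g : ℕ)
    (hgirth : ∀ (v : V) (c : G.Walk v v), c.IsCycle → g ≤ c.length)
    {u : V} (W : G.Walk u u) (hW : W.length < g) :
    ∀ e : Sym2 V, Even (W.edges.count e) := by
  intro e
  have hnil : W.bypass = .nil :=
    (SimpleGraph.Walk.isPath_iff_nil.mp W.bypass_isPath).eq_nil
  simpa [hnil] using W.even_count_edges_add_count_edges_bypass hgirth hW e
end
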